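/- arXiv:2307.04733 — 10 statements merged into one kernel-verified Lean document; each statement's English description precedes it below -/
import Mathlib

section
/- Advanced joint convexity of the quantum hockey-stick divergence: let ρ₀, ρ₁, ρ₂ be density matrices on ℂ^d, let p ∈ [0,1] and γ ≥ 1, and set γ' = 1 + (1−p)(γ−1) and β = γ'/γ. Then E_{γ'}(p·ρ₀ + (1−p)·ρ₁ ‖ p·ρ₀ + (1−p)·ρ₂) ≤ (1−p)(1−β)·E_γ(ρ₁‖ρ₀) + (1−p)·β·E_γ(ρ₁‖ρ₂). -/
open scoped ComplexOrder

/-- Trace of the positive part of a Hermitian matrix: the sum of its positive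
eigenvalues counted with multiplicity (junk value `0` if not Hermitian). -/
noncomputable def posPartTrace {d : ℕ} (X : Matrix (Fin d) (Fin d) ℂ) : ℝ :=
  if h : X.IsHermitian then ∑ i, max (h.eigenvalues i) 0 else 0

/-- The quantum hockey-stick divergence `E_γ(ρ‖σ) := Tr[(ρ - γ·σ)⁺]`. -/
noncomputable def hsDiv {d : ℕ} (γ : ℝ) (ρ σ : Matrix (Fin d) (Fin d) ℂ) : ℝ :=
  posPartTrace (ρ - (γ : ℂ) • σ)

/-- A density matrix: positive semidefinite with trace one. -/
def IsDensityMatrix {d : ℕ} (ρ : Matrix (Fin d) (Fin d) ℂ) : Prop :=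
  ρ.PosSemidef ∧ ρ.trace = 1

namespace Matrix.IsHermitian

variable {d : ℕ} {X : Matrix (Fin d) (Fin d) ℂ}

/-- The trace of `Q * X` computed in an eigenbasis of `X`. -/
lemma trace_mul_eq_sum_eigenvalues (h : X.IsHermitian) (Q : Matrix (Fin d) (Fin d) ℂ) :
    (Q * X).trace = ∑ i, ((h.eigenvectorUnitary : Matrix (Fin d) (Fin d) ℂ)ᴴ * Q *
      (h.eigenvectorUnitary : Matrix (Fin d) (Fin d) ℂ)) i i * (h.eigenvalues i : ℂ) := by
  set U : Matrix (Fin d) (Fin d) ℂ := (h.eigenvectorUnitary : Matrix (Fin d) (Fin d) ℂ) with hU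
  have hX : X = U * diagonal (fun i => (h.eigenvalues i : ℂ)) * Uᴴ := by
    conv_lhs => rw [h.spectral_theorem]
    rfl
  have hd : (Q * X).trace = (Uᴴ * Q * U * diagonal (fun i => (h.eigenvalues i : ℂ))).trace := by
    conv_lhs => rw [hX, ← Matrix.mul_assoc, Matrix.trace_mul_comm]
    simp only [Matrix.mul_assoc]
  rw [hd, Matrix.trace]
  simp [Matrix.mul_diagonal]

/-- Variational upper bound: a test `0 ≤ Q ≤ 1` never exceeds the trace of the positive part. -/
lemma re_trace_mul_le_posPartTrace (h : X.IsHermitian) {Q : Matrix (Fin d) (Fin d) ℂ}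
    (hQ : Q.PosSemidef) (hQ' : (1 - Q).PosSemidef) : (Q * X).trace.re ≤ posPartTrace X := by
  rw [posPartTrace, dif_pos h, h.trace_mul_eq_sum_eigenvalues, Complex.re_sum]
  refine Finset.sum_le_sum fun i _ => ?_
  set U : Matrix (Fin d) (Fin d) ℂ := (h.eigenvectorUnitary : Matrix (Fin d) (Fin d) ℂ) with hU
  have hUU : Uᴴ * U = 1 := Unitary.coe_star_mul_self h.eigenvectorUnitary
  have hnonneg : 0 ≤ ((Uᴴ * Q * U) i i).re :=
    (Complex.le_def.1 ((hQ.conjTranspose_mul_mul_same U).diag_nonneg (i := i))).1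
  have hle : ((Uᴴ * Q * U) i i).re ≤ 1 := by
    have := (Complex.le_def.1 ((hQ'.conjTranspose_mul_mul_same U).diag_nonneg (i := i))).1
    rw [Matrix.mul_sub, Matrix.sub_mul, Matrix.mul_one, hUU] at this
    simpa using this
  rw [Complex.re_mul_ofReal]
  calc _ ≤ ((Uᴴ * Q * U) i i).re * max (h.eigenvalues i) 0 :=
        mul_le_mul_of_nonneg_left (le_max_left _ _) hnonneg
    _ ≤ _ := mul_le_of_le_one_left (le_max_right _ _) hle

/-- The spectral projection onto the positive eigenvalues attains the trace of the positive
part. -/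
lemma exists_re_trace_mul_eq_posPartTrace (h : X.IsHermitian) :
    ∃ Q : Matrix (Fin d) (Fin d) ℂ, Q.PosSemidef ∧ (1 - Q).PosSemidef ∧
      (Q * X).trace.re = posPartTrace X := by
  set U : Matrix (Fin d) (Fin d) ℂ := (h.eigenvectorUnitary : Matrix (Fin d) (Fin d) ℂ) with hU
  have hUU : Uᴴ * U = 1 := Unitary.coe_star_mul_self h.eigenvectorUnitary
  have hUU' : U * Uᴴ = 1 := Unitary.coe_mul_star_self h.eigenvectorUnitary
  set e : Fin d → ℂ := fun i => if 0 < h.eigenvalues i then 1 else 0 with he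
  refine ⟨U * diagonal e * Uᴴ, ?_, ?_, ?_⟩
  · refine PosSemidef.mul_mul_conjTranspose_same (PosSemidef.diagonal fun i => ?_) U
    simp only [he]
    split_ifs <;> simp
  · have hsub : 1 - U * diagonal e * Uᴴ = U * diagonal (1 - e) * Uᴴ := by
      have hdiag : diagonal (1 - e) = (1 : Matrix (Fin d) (Fin d) ℂ) - diagonal e := by
        rw [← diagonal_one, diagonal_sub]
        rfl
      rw [hdiag, Matrix.mul_sub, Matrix.sub_mul, Matrix.mul_one, hUU']
    rw [hsub]
    refine PosSemidef.mul_mul_conjTranspose_same (PosSemidef.diagonal fun i => ?_) U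
    simp only [he, Pi.sub_apply, Pi.one_apply]
    split_ifs <;> simp
  · have hconj : Uᴴ * (U * diagonal e * Uᴴ) * U = diagonal e := by
      calc _ = (Uᴴ * U) * diagonal e * (Uᴴ * U) := by simp only [Matrix.mul_assoc]
        _ = _ := by rw [hUU, Matrix.one_mul, Matrix.mul_one]
    rw [posPartTrace, dif_pos h, h.trace_mul_eq_sum_eigenvalues, ← hU, hconj, Complex.re_sum]
    refine Finset.sum_congr rfl fun i _ => ?_
    rw [diagonal_apply_eq, Complex.re_mul_ofReal]
    by_cases hi : 0 < h.eigenvalues i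
    · simp [he, hi, hi.le]
    · simp [he, hi, not_lt.1 hi]

end Matrix.IsHermitian

/-- Sublinearity of the trace of the positive part. -/
lemma posPartTrace_smul_add_smul_le {d : ℕ} {X Y : Matrix (Fin d) (Fin d) ℂ}
    (hX : X.IsHermitian) (hY : Y.IsHermitian) {a b : ℝ} (ha : 0 ≤ a) (hb : 0 ≤ b) :
    posPartTrace ((a : ℂ) • X + (b : ℂ) • Y) ≤ a * posPartTrace X + b * posPartTrace Y := by
  have hXY : ((a : ℂ) • X + (b : ℂ) • Y).IsHermitian :=
    (hX.smul (Complex.conj_ofReal a)).add (hY.smul (Complex.conj_ofReal b))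
  obtain ⟨Q, hQ, hQ', hQeq⟩ := hXY.exists_re_trace_mul_eq_posPartTrace
  rw [← hQeq, Matrix.mul_add, Matrix.mul_smul, Matrix.mul_smul, Matrix.trace_add,
    Matrix.trace_smul, Matrix.trace_smul, smul_eq_mul, smul_eq_mul, Complex.add_re,
    Complex.re_ofReal_mul, Complex.re_ofReal_mul]
  exact add_le_add
    (mul_le_mul_of_nonneg_left (hX.re_trace_mul_le_posPartTrace hQ hQ') ha)
    (mul_le_mul_of_nonneg_left (hY.re_trace_mul_le_posPartTrace hQ hQ') hb)

/-- Advanced joint convexity of the quantum hockey-stick divergence. -/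
theorem advanced_joint_convexity_quantum_hockey_stick {d : ℕ}
    (ρ₀ ρ₁ ρ₂ : Matrix (Fin d) (Fin d) ℂ)
    (h₀ : IsDensityMatrix ρ₀) (h₁ : IsDensityMatrix ρ₁) (h₂ : IsDensityMatrix ρ₂)
    (p γ : ℝ) (hp0 : 0 ≤ p) (hp1 : p ≤ 1) (hγ : 1 ≤ γ)
    (γ' β : ℝ) (hγ' : γ' = 1 + (1 - p) * (γ - 1)) (hβ : β = γ' / γ) :
    hsDiv γ' ((p : ℂ) • ρ₀ + ((1 - p : ℝ) : ℂ) • ρ₁)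
             ((p : ℂ) • ρ₀ + ((1 - p : ℝ) : ℂ) • ρ₂)
      ≤ (1 - p) * (1 - β) * hsDiv γ ρ₁ ρ₀ + (1 - p) * β * hsDiv γ ρ₁ ρ₂ := by
  have hγ0 : 0 < γ := by linarith
  have hγ_le : γ' ≤ γ := by nlinarith
  have hγ_nonneg : 0 ≤ γ' := by nlinarith
  have hβ0 : 0 ≤ β := hβ ▸ div_nonneg hγ_nonneg hγ0.le
  have hβ1 : β ≤ 1 := hβ ▸ (div_le_one hγ0).2 hγ_le
  have hβγ : β * γ = γ' := by rw [hβ, div_mul_cancel₀ _ hγ0.ne']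
  have herm : ∀ σ : Matrix (Fin d) (Fin d) ℂ, IsDensityMatrix σ →
      (ρ₁ - (γ : ℂ) • σ).IsHermitian := fun σ hσ =>
    h₁.1.isHermitian.sub (hσ.1.isHermitian.smul (Complex.conj_ofReal γ))
  have key : ((p : ℂ) • ρ₀ + ((1 - p : ℝ) : ℂ) • ρ₁)
        - (γ' : ℂ) • ((p : ℂ) • ρ₀ + ((1 - p : ℝ) : ℂ) • ρ₂)
      = (((1 - p) * (1 - β) : ℝ) : ℂ) • (ρ₁ - (γ : ℂ) • ρ₀)
        + (((1 - p) * β : ℝ) : ℂ) • (ρ₁ - (γ : ℂ) • ρ₂) := by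
    have hβγ_cast : (β : ℂ) * γ = γ' := by exact_mod_cast hβγ
    have hγ_cast : (γ' : ℂ) = 1 + (1 - p) * (γ - 1) := by exact_mod_cast hγ'
    ext i j
    simp only [Matrix.sub_apply, Matrix.add_apply, Matrix.smul_apply, smul_eq_mul]
    push_cast
    linear_combination (1 - (p : ℂ)) * (ρ₂ i j - ρ₀ i j) * hβγ_cast - ρ₀ i j * hγ_cast
  rw [hsDiv, key]
  exact posPartTrace_smul_add_smul_le (herm ρ₀ h₀) (herm ρ₂ h₂)
    (mul_nonneg (by linarith) (by linarith)) (mul_nonneg (by linarith) hβ0)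
end

section
/- Quantum Bretagnolle–Huber inequality: for any two positive definite density matrices ρ and σ on ℂ^d, (1/2)·‖ρ − σ‖₁ ≤ sqrt(1 − exp(−D(ρ‖σ))), where D(ρ‖σ) = Tr[ρ·(log ρ − log σ)] is the quantum relative entropy. -/
open scoped ComplexOrder

/-- Trace norm of a Hermitian matrix: the sum of the absolute values of its
eigenvalues (junk value `0` if not Hermitian). -/
noncomputable def traceNorm {d : ℕ} (X : Matrix (Fin d) (Fin d) ℂ) : ℝ :=
  if h : X.IsHermitian then ∑ i, |h.eigenvalues i| else 0

/-- Logarithm of a Hermitian matrix, obtained by applying the real logarithm to the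
eigenvalues in a spectral decomposition (junk value `0` if not Hermitian). -/
noncomputable def matLog {d : ℕ} (A : Matrix (Fin d) (Fin d) ℂ) : Matrix (Fin d) (Fin d) ℂ :=
  if h : A.IsHermitian then
    (h.eigenvectorUnitary : Matrix (Fin d) (Fin d) ℂ) *
      Matrix.diagonal (fun i => (Real.log (h.eigenvalues i) : ℂ)) *
      star (h.eigenvectorUnitary : Matrix (Fin d) (Fin d) ℂ)
  else 0

/-- The quantum relative entropy `D(ρ‖σ) = Tr[ρ·(log ρ − log σ)]` of positive definite
density matrices. -/
noncomputable def qRelEnt {d : ℕ} (ρ σ : Matrix (Fin d) (Fin d) ℂ) : ℝ :=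
  ((ρ * (matLog ρ - matLog σ)).trace).re

open Matrix in
/-- The matrix `U * diagonal f * star U` attached to a unitary `U` and a real spectrum `f`. -/
noncomputable def conjDiagonal {d : ℕ} (U : unitaryGroup (Fin d) ℂ) (f : Fin d → ℝ) :
    Matrix (Fin d) (Fin d) ℂ :=
  (U : Matrix (Fin d) (Fin d) ℂ) * diagonal (fun i => (f i : ℂ)) *
    star (U : Matrix (Fin d) (Fin d) ℂ)

namespace conjDiagonal

open Matrix

variable {d : ℕ} (U V : unitaryGroup (Fin d) ℂ) (f g : Fin d → ℝ)

theorem isHermitian : (conjDiagonal U f).IsHermitian := by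
  have hd : (diagonal fun i => (f i : ℂ))ᴴ = diagonal fun i => (f i : ℂ) := by
    rw [diagonal_conjTranspose]
    congr 1
    ext i
    simp
  simp only [IsHermitian, conjDiagonal, conjTranspose_mul, star_eq_conjTranspose,
    conjTranspose_conjTranspose, hd, Matrix.mul_assoc]

theorem mul_self : conjDiagonal U f * conjDiagonal U g = conjDiagonal U (fun i => f i * g i) := by
  have hU : star (U : Matrix (Fin d) (Fin d) ℂ) * U = 1 := Unitary.coe_star_mul_self U
  calc conjDiagonal U f * conjDiagonal U g
      = (U : Matrix (Fin d) (Fin d) ℂ) * diagonal (fun i => (f i : ℂ)) *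
          (star (U : Matrix (Fin d) (Fin d) ℂ) * U) * diagonal (fun i => (g i : ℂ)) *
          star (U : Matrix (Fin d) (Fin d) ℂ) := by
        simp only [conjDiagonal, Matrix.mul_assoc]
    _ = conjDiagonal U (fun i => f i * g i) := by
        rw [hU, Matrix.mul_one, Matrix.mul_assoc (U : Matrix (Fin d) (Fin d) ℂ),
          diagonal_mul_diagonal]
        simp [conjDiagonal]

theorem one : conjDiagonal U (fun _ => 1) = 1 := by
  have hU : (U : Matrix (Fin d) (Fin d) ℂ) * star (U : Matrix (Fin d) (Fin d) ℂ) = 1 :=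
    Unitary.coe_mul_star_self U
  simp [conjDiagonal, hU]

theorem trace : (conjDiagonal U f).trace = ∑ i, (f i : ℂ) := by
  have hU : star (U : Matrix (Fin d) (Fin d) ℂ) * U = 1 := Unitary.coe_star_mul_self U
  rw [conjDiagonal, Matrix.trace_mul_comm, ← Matrix.mul_assoc, hU, Matrix.one_mul,
    trace_diagonal]

/-- The trace of a product expressed through the squared overlaps of the two eigenbases. -/
theorem trace_mul_re :
    (conjDiagonal U f * conjDiagonal V g).trace.re =
      ∑ i, ∑ j, f i * g j * Complex.normSq
        ((star (U : Matrix (Fin d) (Fin d) ℂ) * (V : Matrix (Fin d) (Fin d) ℂ)) i j) := by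
  set W := star (U : Matrix (Fin d) (Fin d) ℂ) * (V : Matrix (Fin d) (Fin d) ℂ) with hW
  have hW' : star (V : Matrix (Fin d) (Fin d) ℂ) * U = Wᴴ := by
    simp [hW, star_eq_conjTranspose]
  have h : (conjDiagonal U f * conjDiagonal V g).trace =
      (diagonal (fun i => (f i : ℂ)) * (W * (diagonal (fun i => (g i : ℂ)) * Wᴴ))).trace := by
    rw [← hW', hW]
    simp only [conjDiagonal, Matrix.mul_assoc]
    rw [Matrix.trace_mul_comm]
    simp only [Matrix.mul_assoc]
  rw [h, Matrix.trace, Complex.re_sum]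
  refine Finset.sum_congr rfl fun i _ => ?_
  rw [diag_apply, diagonal_mul, Matrix.mul_apply, Finset.mul_sum, Complex.re_sum]
  refine Finset.sum_congr rfl fun j _ => ?_
  rw [diagonal_mul, conjTranspose_apply]
  simp [Complex.normSq_apply]
  ring

end conjDiagonal

namespace Matrix

variable {d : ℕ}

theorem IsHermitian.eq_conjDiagonal {A : Matrix (Fin d) (Fin d) ℂ} (hA : A.IsHermitian) :
    A = conjDiagonal hA.eigenvectorUnitary hA.eigenvalues := by
  conv_lhs => rw [hA.spectral_theorem]
  rfl

theorem IsHermitian.matLog_eq {A : Matrix (Fin d) (Fin d) ℂ} (hA : A.IsHermitian) :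
    matLog A = conjDiagonal hA.eigenvectorUnitary (fun i => Real.log (hA.eigenvalues i)) := by
  rw [matLog, dif_pos hA, conjDiagonal]

/-- The Cauchy–Schwarz inequality for the Hilbert–Schmidt inner product. -/
theorem re_trace_conjTranspose_mul_sq_le (A B : Matrix (Fin d) (Fin d) ℂ) :
    (Aᴴ * B).trace.re ^ 2 ≤ (Aᴴ * A).trace.re * (Bᴴ * B).trace.re := by
  have hsymm : (Bᴴ * A).trace.re = (Aᴴ * B).trace.re := by
    have : Bᴴ * A = (Aᴴ * B)ᴴ := by simp
    rw [this, trace_conjTranspose]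
    simp
  have hquad (t : ℝ) : 0 ≤ (Bᴴ * B).trace.re * (t * t) + 2 * (Aᴴ * B).trace.re * t +
      (Aᴴ * A).trace.re := by
    have h := (Complex.le_def.1
      (posSemidef_conjTranspose_mul_self (A + (t : ℂ) • B)).trace_nonneg).1
    simp only [conjTranspose_add, conjTranspose_smul, add_mul, mul_add, smul_mul, Matrix.mul_smul,
      trace_add, trace_smul, Complex.add_re, Complex.zero_re, smul_eq_mul, Complex.star_def,
      Complex.conj_ofReal, Complex.re_ofReal_mul, hsymm] at h
    linarith
  have := discrim_le_zero hquad
  rw [discrim] at this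
  linarith

/-- A Hermitian matrix attains its trace norm against a Hermitian involution. -/
theorem IsHermitian.exists_trace_eq_traceNorm {X : Matrix (Fin d) (Fin d) ℂ}
    (hX : X.IsHermitian) :
    ∃ Z : Matrix (Fin d) (Fin d) ℂ, Z.IsHermitian ∧ Z * Z = 1 ∧
      (Z * X).trace.re = traceNorm X := by
  set s : Fin d → ℝ := fun i => if 0 ≤ hX.eigenvalues i then 1 else -1 with hs
  refine ⟨conjDiagonal hX.eigenvectorUnitary s, conjDiagonal.isHermitian _ _, ?_, ?_⟩
  · rw [conjDiagonal.mul_self, ← conjDiagonal.one hX.eigenvectorUnitary]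
    congr 1
    ext i
    simp only [hs]
    split_ifs <;> norm_num
  · have hZX : conjDiagonal hX.eigenvectorUnitary s * X =
        conjDiagonal hX.eigenvectorUnitary (fun i => s i * hX.eigenvalues i) := by
      rw [← conjDiagonal.mul_self, ← hX.eq_conjDiagonal]
    rw [hZX, conjDiagonal.trace, Complex.re_sum, traceNorm, dif_pos hX]
    refine Finset.sum_congr rfl fun i _ => ?_
    rw [Complex.ofReal_re]
    simp only [hs]
    split_ifs with h
    · rw [abs_of_nonneg h, one_mul]
    · rw [abs_of_neg (not_le.1 h), neg_one_mul]

/-- The trace norm of a difference of squares is controlled by Hilbert–Schmidt norms. -/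
theorem IsHermitian.traceNorm_sq_sub_sq_le {R S : Matrix (Fin d) (Fin d) ℂ}
    (hR : R.IsHermitian) (hS : S.IsHermitian) :
    traceNorm (R * R - S * S) ^ 2 ≤
      ((R - S) * (R - S)).trace.re * ((R + S) * (R + S)).trace.re := by
  have hRS : (R * R - S * S).IsHermitian := by
    simp only [IsHermitian, conjTranspose_sub, conjTranspose_mul, hR.eq, hS.eq]
  obtain ⟨Z, hZ, hZZ, hZt⟩ := hRS.exists_trace_eq_traceNorm
  have hX : (R - S)ᴴ = R - S := (hR.sub hS).eq
  have hY : (R + S)ᴴ = R + S := (hR.add hS).eq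
  have hsymm : (Z * ((R + S) * (R - S))).trace.re = (Z * ((R - S) * (R + S))).trace.re := by
    have : Z * ((R + S) * (R - S)) = ((R - S) * (R + S) * Z)ᴴ := by
      rw [conjTranspose_mul, conjTranspose_mul, hX, hY, hZ.eq]
    rw [this, trace_conjTranspose, trace_mul_comm]
    simp
  have hsplit : (2 : ℝ) • (Z * (R * R - S * S)) =
      Z * ((R + S) * (R - S)) + Z * ((R - S) * (R + S)) := by
    rw [two_smul]
    noncomm_ring
  have hval : traceNorm (R * R - S * S) = (((R - S) * Z)ᴴ * (R + S)).trace.re := by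
    have h := congrArg (fun M => (trace M).re) hsplit
    simp only [trace_smul, trace_add, Complex.add_re, Complex.smul_re, smul_eq_mul,
      hsymm, hZt] at h
    rw [conjTranspose_mul, hX, hZ.eq, Matrix.mul_assoc]
    linarith
  have hnorm : (((R - S) * Z)ᴴ * ((R - S) * Z)).trace = ((R - S) * (R - S)).trace := by
    rw [conjTranspose_mul, hX, hZ.eq, Matrix.mul_assoc, trace_mul_comm]
    simp only [Matrix.mul_assoc, hZZ, Matrix.mul_one]
  have h := re_trace_conjTranspose_mul_sq_le ((R - S) * Z) (R + S)
  rwa [← hval, hnorm, hY] at h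

/-- The affinity `Tr[√ρ√σ]` of two states is at least `exp (-D(ρ‖σ) / 2)`. -/
theorem PosDef.exp_neg_qRelEnt_le {ρ σ : Matrix (Fin d) (Fin d) ℂ}
    (hρ : ρ.PosDef) (hρt : ρ.trace = 1) (hσ : σ.PosDef) :
    Real.exp (-qRelEnt ρ σ / 2) ≤
      (conjDiagonal hρ.1.eigenvectorUnitary (fun i => √(hρ.1.eigenvalues i)) *
        conjDiagonal hσ.1.eigenvectorUnitary (fun i => √(hσ.1.eigenvalues i))).trace.re := by
  set U := hρ.1.eigenvectorUnitary
  set V := hσ.1.eigenvectorUnitary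
  set p := hρ.1.eigenvalues
  set q := hσ.1.eigenvalues
  have hp : ∀ i, 0 < p i := hρ.eigenvalues_pos
  have hq : ∀ i, 0 < q i := hσ.eigenvalues_pos
  have hρU : ρ = conjDiagonal U p := hρ.1.eq_conjDiagonal
  set w : Fin d → Fin d → ℝ := fun i j => Complex.normSq
    ((star (U : Matrix (Fin d) (Fin d) ℂ) * (V : Matrix (Fin d) (Fin d) ℂ)) i j)
  have hw (f g : Fin d → ℝ) : (conjDiagonal U f * conjDiagonal V g).trace.re =
      ∑ x : Fin d × Fin d, f x.1 * g x.2 * w x.1 x.2 := by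
    rw [conjDiagonal.trace_mul_re, Fintype.sum_prod_type]
  have hsum : ∑ x : Fin d × Fin d, p x.1 * w x.1 x.2 = 1 := by
    have h := hw p (fun _ => 1)
    rw [conjDiagonal.one, Matrix.mul_one, ← hρU, hρt] at h
    simpa using h.symm
  have hD : qRelEnt ρ σ =
      ∑ x : Fin d × Fin d, p x.1 * w x.1 x.2 * (Real.log (p x.1) - Real.log (q x.2)) := by
    have h1 : (ρ * matLog ρ).trace.re =
        ∑ x : Fin d × Fin d, p x.1 * Real.log (p x.1) * 1 * w x.1 x.2 := by
      rw [← hw (fun i => p i * Real.log (p i)) (fun _ => 1), conjDiagonal.one, Matrix.mul_one,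
        ← conjDiagonal.mul_self, ← hρU, hρ.1.matLog_eq]
    have h2 : (ρ * matLog σ).trace.re =
        ∑ x : Fin d × Fin d, p x.1 * Real.log (q x.2) * w x.1 x.2 := by
      rw [← hw p (fun j => Real.log (q j)), ← hρU, hσ.1.matLog_eq]
    rw [qRelEnt, Matrix.mul_sub, trace_sub, Complex.sub_re, h1, h2, ← Finset.sum_sub_distrib]
    exact Finset.sum_congr rfl fun x _ => by ring
  have hJ := convexOn_exp.map_sum_le (t := Finset.univ)
    (w := fun x : Fin d × Fin d => p x.1 * w x.1 x.2)
    (p := fun x => -(Real.log (p x.1) - Real.log (q x.2)) / 2)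
    (fun x _ => mul_nonneg (hp _).le (Complex.normSq_nonneg _)) hsum (fun _ _ => Set.mem_univ _)
  rw [hw]
  calc Real.exp (-qRelEnt ρ σ / 2)
      = Real.exp (∑ x : Fin d × Fin d,
          (p x.1 * w x.1 x.2) • (-(Real.log (p x.1) - Real.log (q x.2)) / 2)) := by
        rw [hD, ← Finset.sum_neg_distrib, Finset.sum_div]
        congr 1
        exact Finset.sum_congr rfl fun x _ => by rw [smul_eq_mul]; ring
    _ ≤ _ := hJ
    _ = ∑ x : Fin d × Fin d, √(p x.1) * √(q x.2) * w x.1 x.2 := by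
        refine Finset.sum_congr rfl fun x _ => ?_
        have he : Real.exp (-(Real.log (p x.1) - Real.log (q x.2)) / 2) =
            √(q x.2) / √(p x.1) := by
          rw [neg_sub, sub_div, Real.exp_sub, Real.exp_half, Real.exp_half,
            Real.exp_log (hp _), Real.exp_log (hq _)]
        have hs : √(p x.1) ≠ 0 := (Real.sqrt_pos.2 (hp _)).ne'
        rw [he, smul_eq_mul]
        nth_rewrite 1 [← Real.mul_self_sqrt (hp x.1).le]
        field_simp

end Matrix

/-- Quantum Bretagnolle–Huber inequality. -/
theorem quantum_bretagnolle_huber {d : ℕ} (ρ σ : Matrix (Fin d) (Fin d) ℂ)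
    (hρ : ρ.PosDef) (hρt : ρ.trace = 1) (hσ : σ.PosDef) (hσt : σ.trace = 1) :
    (1 / 2) * traceNorm (ρ - σ) ≤ Real.sqrt (1 - Real.exp (-qRelEnt ρ σ)) := by
  set R := conjDiagonal hρ.1.eigenvectorUnitary (fun i => √(hρ.1.eigenvalues i)) with hRdef
  set S := conjDiagonal hσ.1.eigenvectorUnitary (fun i => √(hσ.1.eigenvalues i)) with hSdef
  have hRR : R * R = ρ := by
    conv_rhs => rw [hρ.1.eq_conjDiagonal]
    rw [hRdef, conjDiagonal.mul_self]
    congr 1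
    ext i
    exact Real.mul_self_sqrt (hρ.eigenvalues_pos i).le
  have hSS : S * S = σ := by
    conv_rhs => rw [hσ.1.eq_conjDiagonal]
    rw [hSdef, conjDiagonal.mul_self]
    congr 1
    ext i
    exact Real.mul_self_sqrt (hσ.eigenvalues_pos i).le
  have hA : Real.exp (-qRelEnt ρ σ / 2) ≤ (R * S).trace.re :=
    hρ.exp_neg_qRelEnt_le hρt hσ
  have hA2 : Real.exp (-qRelEnt ρ σ) ≤ (R * S).trace.re ^ 2 := by
    have he : Real.exp (-qRelEnt ρ σ) = Real.exp (-qRelEnt ρ σ / 2) ^ 2 := by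
      rw [← Real.exp_nat_mul]
      congr 1
      push_cast
      ring
    rw [he]
    exact pow_le_pow_left₀ (Real.exp_pos _).le hA 2
  have hT := (conjDiagonal.isHermitian _ _ : R.IsHermitian).traceNorm_sq_sub_sq_le
    (conjDiagonal.isHermitian _ _ : S.IsHermitian)
  have hX : ((R - S) * (R - S)).trace.re = 2 - 2 * (R * S).trace.re := by
    rw [Matrix.sub_mul, Matrix.mul_sub, Matrix.mul_sub, hRR, hSS]
    simp only [Matrix.trace_sub, Complex.sub_re, hρt, hσt, Complex.one_re,
      Matrix.trace_mul_comm S R]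
    ring
  have hY : ((R + S) * (R + S)).trace.re = 2 + 2 * (R * S).trace.re := by
    rw [Matrix.add_mul, Matrix.mul_add, Matrix.mul_add, hRR, hSS]
    simp only [Matrix.trace_add, Complex.add_re, hρt, hσt, Complex.one_re,
      Matrix.trace_mul_comm S R]
    ring
  rw [hX, hY, hRR, hSS] at hT
  apply Real.le_sqrt_of_sq_le
  nlinarith
end

section
/- Privacy bound for generalized depolarizing channels via advanced joint convexity: let M be a positive, unital, trace-preserving linear map on 2^n × 2^n complex matrices and define N_p(X) := p·Tr[X]·(I/2^n) + (1−p)·M(X). For 0 ≤ p ≤ 1 and γ ≥ 1, setting γ' = 1 + (1−p)(γ−1) and β = γ'/γ, for all density matrices ρ, σ one has E_{γ'}(N_p(ρ)‖N_p(σ)) ≤ (1−p)(1−β)·E_γ(ρ‖I/2^n) + (1−p)·β·E_γ(ρ‖σ). -/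
open scoped ComplexOrder

/-- The maximally mixed state `I / d`. -/
noncomputable def maxMixed (d : ℕ) : Matrix (Fin d) (Fin d) ℂ :=
  ((d : ℂ))⁻¹ • (1 : Matrix (Fin d) (Fin d) ℂ)

/-- The generalized depolarizing channel
`N_p(X) := p·Tr[X]·(I/d) + (1−p)·M(X)`. -/
noncomputable def genDepol {d : ℕ} (p : ℝ)
    (M : Matrix (Fin d) (Fin d) ℂ →ₗ[ℂ] Matrix (Fin d) (Fin d) ℂ)
    (X : Matrix (Fin d) (Fin d) ℂ) : Matrix (Fin d) (Fin d) ℂ :=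
  ((p : ℂ) * X.trace) • maxMixed d + ((1 - p : ℝ) : ℂ) • M X

namespace Matrix.IsHermitian

variable {d : ℕ} {X : Matrix (Fin d) (Fin d) ℂ}

theorem eq_eigenvectorUnitary_conj (hX : X.IsHermitian) :
    X = (hX.eigenvectorUnitary : Matrix (Fin d) (Fin d) ℂ)
      * Matrix.diagonal (fun i => (hX.eigenvalues i : ℂ))
      * (hX.eigenvectorUnitary : Matrix (Fin d) (Fin d) ℂ)ᴴ := by
  conv_lhs => rw [hX.spectral_theorem]
  rfl

/-- The trace of the positive part is attained by a positive semidefinite upper bound. -/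
theorem exists_posSemidef_trace_eq_posPartTrace (hX : X.IsHermitian) :
    ∃ P : Matrix (Fin d) (Fin d) ℂ,
      P.PosSemidef ∧ (P - X).PosSemidef ∧ P.trace.re = posPartTrace X := by
  set U := (hX.eigenvectorUnitary : Matrix (Fin d) (Fin d) ℂ) with hU
  have hUU : Uᴴ * U = 1 := Unitary.coe_star_mul_self hX.eigenvectorUnitary
  refine ⟨U * Matrix.diagonal (fun i => ((max (hX.eigenvalues i) 0 : ℝ) : ℂ)) * Uᴴ, ?_, ?_, ?_⟩
  · refine Matrix.PosSemidef.mul_mul_conjTranspose_same (Matrix.PosSemidef.diagonal fun i => ?_) U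
    exact Complex.zero_le_real.2 (le_max_right _ _)
  · have h : U * Matrix.diagonal (fun i => ((max (hX.eigenvalues i) 0 : ℝ) : ℂ)) * Uᴴ - X
        = U * Matrix.diagonal
          (fun i => ((max (hX.eigenvalues i) 0 - hX.eigenvalues i : ℝ) : ℂ)) * Uᴴ := by
      conv_lhs => arg 2; rw [hX.eq_eigenvectorUnitary_conj, ← hU]
      rw [← Matrix.sub_mul, ← Matrix.mul_sub, Matrix.diagonal_sub]
      push_cast
      rfl
    rw [h]
    refine Matrix.PosSemidef.mul_mul_conjTranspose_same (Matrix.PosSemidef.diagonal fun i => ?_) U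
    exact Complex.zero_le_real.2 (sub_nonneg.2 (le_max_left _ _))
  · rw [Matrix.trace_mul_cycle, hUU, Matrix.one_mul, Matrix.trace_diagonal, posPartTrace,
      dif_pos hX, ← Complex.ofReal_sum, Complex.ofReal_re]

/-- Every positive semidefinite upper bound has trace at least that of the positive part. -/
theorem posPartTrace_le_trace (hX : X.IsHermitian) {P : Matrix (Fin d) (Fin d) ℂ}
    (hP : P.PosSemidef) (hPX : (P - X).PosSemidef) : posPartTrace X ≤ P.trace.re := by
  set U := (hX.eigenvectorUnitary : Matrix (Fin d) (Fin d) ℂ) with hU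
  have hUU : Uᴴ * U = 1 := Unitary.coe_star_mul_self hX.eigenvectorUnitary
  have hUU' : U * Uᴴ = 1 := Unitary.coe_mul_star_self hX.eigenvectorUnitary
  have hdiag : Uᴴ * X * U = Matrix.diagonal (fun i => (hX.eigenvalues i : ℂ)) := by
    conv_lhs => rw [hX.eq_eigenvectorUnitary_conj, ← hU]
    simp only [Matrix.mul_assoc, hUU, Matrix.mul_one]
    rw [← Matrix.mul_assoc, hUU, Matrix.one_mul]
  have htrace : P.trace = (Uᴴ * P * U).trace := by
    rw [Matrix.trace_mul_cycle, hUU', Matrix.one_mul]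
  rw [htrace, Matrix.trace, Complex.re_sum, posPartTrace, dif_pos hX]
  refine Finset.sum_le_sum fun i _ => max_le ?_ ?_
  · have h := (hPX.conjTranspose_mul_mul_same U).diag_nonneg (i := i)
    rw [Matrix.mul_sub, Matrix.sub_mul, hdiag, Matrix.sub_apply, Matrix.diagonal_apply_eq] at h
    simpa using (Complex.le_def.1 h).1
  · simpa using (Complex.le_def.1 ((hP.conjTranspose_mul_mul_same U).diag_nonneg (i := i))).1

end Matrix.IsHermitian

/-- Privacy bound for generalized depolarizing channels via advanced joint convexity. -/
theorem genDepol_privacy_advanced_joint_convexity {n : ℕ}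
    (M : Matrix (Fin (2 ^ n)) (Fin (2 ^ n)) ℂ →ₗ[ℂ] Matrix (Fin (2 ^ n)) (Fin (2 ^ n)) ℂ)
    (hMpos : ∀ X : Matrix (Fin (2 ^ n)) (Fin (2 ^ n)) ℂ, X.PosSemidef → (M X).PosSemidef)
    (hMunital : M 1 = 1)
    (hMtp : ∀ X : Matrix (Fin (2 ^ n)) (Fin (2 ^ n)) ℂ, (M X).trace = X.trace)
    (p γ : ℝ) (hp0 : 0 ≤ p) (hp1 : p ≤ 1) (hγ : 1 ≤ γ)
    (γ' β : ℝ) (hγ' : γ' = 1 + (1 - p) * (γ - 1)) (hβ : β = γ' / γ)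
    (ρ σ : Matrix (Fin (2 ^ n)) (Fin (2 ^ n)) ℂ)
    (hρ : IsDensityMatrix ρ) (hσ : IsDensityMatrix σ) :
    hsDiv γ' (genDepol p M ρ) (genDepol p M σ)
      ≤ (1 - p) * (1 - β) * hsDiv γ ρ (maxMixed (2 ^ n))
          + (1 - p) * β * hsDiv γ ρ σ := by
  have hγ0 : 0 < γ := by linarith
  have hp : 0 ≤ 1 - p := by linarith
  have hβγ : β * γ = γ' := by rw [hβ]; field_simp
  have hβ0 : 0 ≤ β := by
    rw [hβ, hγ']
    exact div_nonneg (by nlinarith) hγ0.le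
  have hβ1 : 0 ≤ 1 - β := by
    rw [hβ, sub_nonneg, div_le_one hγ0, hγ']
    nlinarith
  have hreal (r : ℝ) : IsSelfAdjoint (r : ℂ) := Complex.conj_ofReal r
  have hmm : (maxMixed (2 ^ n)).IsHermitian := by
    refine Matrix.isHermitian_one.smul ?_
    simp [IsSelfAdjoint]
  set A := ρ - (γ : ℂ) • maxMixed (2 ^ n) with hA
  set B := ρ - (γ : ℂ) • σ with hB
  have hAh : A.IsHermitian := hρ.1.isHermitian.sub (hmm.smul (hreal γ))
  obtain ⟨P, hP, hPA, hPtr⟩ := hAh.exists_posSemidef_trace_eq_posPartTrace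
  have hBh : B.IsHermitian := hρ.1.isHermitian.sub (hσ.1.isHermitian.smul (hreal γ))
  obtain ⟨Q, hQ, hQB, hQtr⟩ := hBh.exists_posSemidef_trace_eq_posPartTrace
  have hMm : M (maxMixed (2 ^ n)) = maxMixed (2 ^ n) := by
    rw [maxMixed, map_smul, hMunital]
  have hmix : genDepol p M ρ - (γ' : ℂ) • genDepol p M σ
      = ((1 - p : ℝ) : ℂ) • M (((1 - β : ℝ) : ℂ) • A + (β : ℂ) • B) := by
    have hβγ' : (β : ℂ) * γ = γ' := by exact_mod_cast hβγ
    have hγ'' : (γ' : ℂ) = 1 + (1 - p) * (γ - 1) := by exact_mod_cast hγ'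
    simp only [genDepol, hρ.2, hσ.2, hA, hB, map_add, map_sub, map_smul, hMm]
    push_cast
    match_scalars
    · linear_combination -hγ'' - (1 - p : ℂ) * hβγ'
    · ring
    · linear_combination (1 - p : ℂ) * hβγ'
  have hdom (a b : ℝ) (ha : 0 ≤ a) (hb : 0 ≤ b) {S T : Matrix (Fin (2 ^ n)) (Fin (2 ^ n)) ℂ}
      (hS : S.PosSemidef) (hT : T.PosSemidef) :
      (((1 - p : ℝ) : ℂ) • M ((a : ℂ) • S + (b : ℂ) • T)).PosSemidef :=
    (hMpos _ ((hS.smul (Complex.zero_le_real.2 ha)).add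
      (hT.smul (Complex.zero_le_real.2 hb)))).smul (Complex.zero_le_real.2 hp)
  have hPSD := hdom _ _ hβ1 hβ0 hP hQ
  have hdiff : (((1 - p : ℝ) : ℂ) • M (((1 - β : ℝ) : ℂ) • P + (β : ℂ) • Q)
      - ((1 - p : ℝ) : ℂ) • M (((1 - β : ℝ) : ℂ) • A + (β : ℂ) • B)).PosSemidef := by
    convert hdom _ _ hβ1 hβ0 hPA hQB using 1
    simp only [map_add, map_sub, map_smul]
    module
  have hherm : (((1 - p : ℝ) : ℂ) • M (((1 - β : ℝ) : ℂ) • A + (β : ℂ) • B)).IsHermitian := by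
    simpa using hPSD.isHermitian.sub hdiff.isHermitian
  rw [hsDiv, hsDiv, hsDiv, hmix, ← hA, ← hB, ← hPtr, ← hQtr]
  refine (hherm.posPartTrace_le_trace hPSD hdiff).trans_eq ?_
  rw [Matrix.trace_smul, hMtp, Matrix.trace_add, Matrix.trace_smul, Matrix.trace_smul]
  simp only [smul_eq_mul, Complex.re_ofReal_mul, Complex.add_re]
  ring
end

section
/- Depolarizing-type privacy bound for an arbitrary inner channel: let M be a positive, trace-preserving linear map on 2^n × 2^n complex matrices and define N_p(X) := p·Tr[X]·(I/2^n) + (1−p)·M(X). For 0 ≤ p ≤ 1 and γ' ≥ 1, for all density matrices ρ, σ one has E_{γ'}(N_p(ρ)‖N_p(σ)) ≤ max{0, (1−γ')·p/2^n + (1−p)·E_{γ'}(ρ‖σ)}. -/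
open scoped ComplexOrder

section

open scoped Matrix

/-- A Hermitian matrix is dominated by a positive semidefinite matrix whose trace is the trace
of its positive part. -/
theorem Matrix.IsHermitian.exists_posSemidef_trace_eq_posPartTrace_s3 {d : ℕ}
    {X : Matrix (Fin d) (Fin d) ℂ} (hX : X.IsHermitian) :
    ∃ P : Matrix (Fin d) (Fin d) ℂ,
      P.PosSemidef ∧ (P - X).PosSemidef ∧ P.trace = (posPartTrace X : ℂ) := by
  set U : Matrix (Fin d) (Fin d) ℂ := hX.eigenvectorUnitary.1
  have hUU : Uᴴ * U = 1 := Matrix.mem_unitaryGroup_iff'.mp hX.eigenvectorUnitary.2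
  have hspec : X = U * Matrix.diagonal (fun i => (hX.eigenvalues i : ℂ)) * Uᴴ := by
    have h := hX.spectral_theorem
    rw [Unitary.conjStarAlgAut_apply] at h
    exact h
  refine ⟨U * Matrix.diagonal (fun i => ((max (hX.eigenvalues i) 0 : ℝ) : ℂ)) * Uᴴ, ?_, ?_, ?_⟩
  · refine Matrix.PosSemidef.mul_mul_conjTranspose_same (Matrix.PosSemidef.diagonal ?_) U
    intro i
    exact Complex.zero_le_real.mpr (le_max_right _ _)
  · conv => enter [1, 2]; rw [hspec]
    rw [← Matrix.sub_mul, ← Matrix.mul_sub, Matrix.diagonal_sub]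
    refine Matrix.PosSemidef.mul_mul_conjTranspose_same (Matrix.PosSemidef.diagonal ?_) U
    intro i
    exact sub_nonneg.mpr (Complex.real_le_real.mpr (le_max_left _ _))
  · rw [Matrix.trace_mul_comm, ← Matrix.mul_assoc, hUU, Matrix.one_mul, Matrix.trace_diagonal,
      posPartTrace, dif_pos hX]
    push_cast
    rfl

/-- If `Z + c • 1` is dominated by a positive semidefinite matrix `P`, then the positive part of
`Z` has trace at most `Tr P - c`, unless it vanishes. -/
theorem posPartTrace_le_max_trace_sub {d : ℕ} {Z P : Matrix (Fin d) (Fin d) ℂ} {c : ℝ}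
    (hc : 0 ≤ c) (hP : P.PosSemidef)
    (hZP : (P - (Z + (c : ℂ) • (1 : Matrix (Fin d) (Fin d) ℂ))).PosSemidef) :
    posPartTrace Z ≤ max 0 (P.trace.re - c) := by
  rw [posPartTrace]
  split_ifs with hZ
  swap
  · exact le_max_left _ _
  by_cases hneg : ∀ i, hZ.eigenvalues i ≤ 0
  · exact (Finset.sum_nonpos fun i _ => max_le (hneg i) le_rfl).trans (le_max_left _ _)
  push Not at hneg
  obtain ⟨j, hj⟩ := hneg
  refine le_max_of_le_right ?_
  set U : Matrix (Fin d) (Fin d) ℂ := hZ.eigenvectorUnitary.1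
  have hUU : Uᴴ * U = 1 := Matrix.mem_unitaryGroup_iff'.mp hZ.eigenvectorUnitary.2
  have hUU' : U * Uᴴ = 1 := Matrix.mem_unitaryGroup_iff.mp hZ.eigenvectorUnitary.2
  have hspec : Z = U * Matrix.diagonal (fun i => (hZ.eigenvalues i : ℂ)) * Uᴴ := by
    have h := hZ.spectral_theorem
    rw [Unitary.conjStarAlgAut_apply] at h
    exact h
  have hdiag : Uᴴ * Z * U = Matrix.diagonal (fun i => (hZ.eigenvalues i : ℂ)) := by
    conv => enter [1, 1, 2]; rw [hspec]
    rw [Matrix.mul_assoc, Matrix.mul_assoc _ Uᴴ, hUU, Matrix.mul_one, ← Matrix.mul_assoc, hUU,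
      Matrix.one_mul]
  have htr : (Uᴴ * P * U).trace = P.trace := by
    rw [Matrix.trace_mul_comm, ← Matrix.mul_assoc, hUU', Matrix.one_mul]
  have hnn : ∀ i, 0 ≤ ((Uᴴ * P * U) i i).re := fun i =>
    (Complex.le_def.mp ((hP.conjTranspose_mul_mul_same U).diag_nonneg (i := i))).1
  have hle : ∀ i, hZ.eigenvalues i + c ≤ ((Uᴴ * P * U) i i).re := by
    intro i
    have h := (Complex.le_def.mp ((hZP.conjTranspose_mul_mul_same U).diag_nonneg (i := i))).1
    rw [Matrix.mul_sub, Matrix.sub_mul, Matrix.mul_add, Matrix.add_mul, hdiag, Matrix.mul_smul,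
      Matrix.smul_mul, Matrix.mul_one, hUU] at h
    simp only [Matrix.sub_apply, Matrix.add_apply, Matrix.diagonal_apply_eq, Matrix.smul_apply,
      Matrix.one_apply_eq, smul_eq_mul, mul_one, Complex.zero_re, Complex.sub_re, Complex.add_re,
      Complex.ofReal_re] at h
    linarith
  have hsum : ∑ i, (max (hZ.eigenvalues i) 0 + if i = j then c else 0)
      ≤ ∑ i, ((Uᴴ * P * U) i i).re := by
    refine Finset.sum_le_sum fun i _ => ?_
    split_ifs with hij
    · subst hij
      rw [max_eq_left hj.le]
      exact hle i
    · rw [add_zero]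
      exact max_le (by linarith [hle i]) (hnn i)
  rw [Finset.sum_add_distrib, Finset.sum_ite_eq' Finset.univ j, if_pos (Finset.mem_univ j)] at hsum
  have hre : P.trace.re = ∑ i, ((Uᴴ * P * U) i i).re := by
    rw [← htr, Matrix.trace, Complex.re_sum]
    rfl
  linarith

end

/-- Depolarizing-type privacy bound for an arbitrary inner channel. -/
theorem genDepol_privacy_max_bound {n : ℕ}
    (M : Matrix (Fin (2 ^ n)) (Fin (2 ^ n)) ℂ →ₗ[ℂ] Matrix (Fin (2 ^ n)) (Fin (2 ^ n)) ℂ)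
    (hMpos : ∀ X : Matrix (Fin (2 ^ n)) (Fin (2 ^ n)) ℂ, X.PosSemidef → (M X).PosSemidef)
    (hMtp : ∀ X : Matrix (Fin (2 ^ n)) (Fin (2 ^ n)) ℂ, (M X).trace = X.trace)
    (p γ' : ℝ) (hp0 : 0 ≤ p) (hp1 : p ≤ 1) (hγ' : 1 ≤ γ')
    (ρ σ : Matrix (Fin (2 ^ n)) (Fin (2 ^ n)) ℂ)
    (hρ : IsDensityMatrix ρ) (hσ : IsDensityMatrix σ) :
    hsDiv γ' (genDepol p M ρ) (genDepol p M σ)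
      ≤ max 0 ((1 - γ') * p / 2 ^ n + (1 - p) * hsDiv γ' ρ σ) := by
  have hX : (ρ - (γ' : ℂ) • σ).IsHermitian := by
    refine hρ.1.isHermitian.sub ?_
    rw [Matrix.IsHermitian, Matrix.conjTranspose_smul, hσ.1.isHermitian.eq]
    simp
  obtain ⟨P, hP, hPX, htr⟩ := hX.exists_posSemidef_trace_eq_posPartTrace_s3
  have hq : (0 : ℂ) ≤ ((1 - p : ℝ) : ℂ) := by exact_mod_cast sub_nonneg.mpr hp1
  have hc : 0 ≤ (γ' - 1) * p / 2 ^ n :=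
    div_nonneg (mul_nonneg (sub_nonneg.mpr hγ') hp0) (by positivity)
  have hdom : (((1 - p : ℝ) : ℂ) • M P - (genDepol p M ρ - (γ' : ℂ) • genDepol p M σ +
      (((γ' - 1) * p / 2 ^ n : ℝ) : ℂ) • 1)).PosSemidef := by
    convert (hMpos _ hPX).smul hq using 1
    simp only [genDepol, maxMixed, hρ.2, hσ.2, map_sub, map_smul]
    push_cast
    module
  refine (posPartTrace_le_max_trace_sub hc ((hMpos P hP).smul hq) hdom).trans_eq ?_
  rw [Matrix.trace_smul, hMtp, htr, smul_eq_mul, ← Complex.ofReal_mul, Complex.ofReal_re, hsDiv]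
  congr 1
  ring
end

section
/- Differential privacy of generalized depolarizing channels with respect to τ-neighbouring states: let M be a positive, unital, trace-preserving linear map on 2^n × 2^n complex matrices, 0 ≤ p < 1, and define N_p(X) := p·Tr[X]·(I/2^n) + (1−p)·M(X). Let ε ≥ 0 and let ρ, σ be density matrices with (1/2)·‖ρ − σ‖₁ ≤ τ. Then (i) E_{e^ε}(N_p(ρ)‖N_p(σ)) ≤ max{0, (1−e^ε)·p/2^n + (1−p)·τ}; and (ii) setting γ = 1 + (e^ε − 1)/(1−p) and β = e^ε/γ, if additionally E_γ(ρ‖I/2^n) ≤ η then E_{e^ε}(N_p(ρ)‖N_p(σ)) ≤ (1−p)(1−β)·η + (1−p)·β·τ. -/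
open scoped ComplexOrder

namespace Matrix

variable {m : Type*} [Fintype m] {A : Matrix m m ℂ}

lemma PosSemidef.trace_proj_mul_re_nonneg {P : Matrix m m ℂ} (hA : A.PosSemidef)
    (hP : P.IsHermitian) (hPP : P * P = P) : 0 ≤ (P * A).trace.re := by
  have h : (P * A).trace = (P * A * Pᴴ).trace := by
    rw [hP.eq, trace_mul_cycle, hPP]
  rw [h]
  exact (Complex.nonneg_iff.mp (hA.mul_mul_conjTranspose_same P).trace_nonneg).1

variable [DecidableEq m]

lemma IsHermitian.cfc_id_eq (hA : A.IsHermitian) : hA.cfc (fun x => x) = A :=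
  hA.spectral_theorem.symm

lemma IsHermitian.cfc_mul_cfc (hA : A.IsHermitian) (f g : ℝ → ℝ) :
    hA.cfc f * hA.cfc g = hA.cfc (fun x => f x * g x) := by
  simp only [IsHermitian.cfc, ← map_mul, diagonal_mul_diagonal]
  congr 2
  ext i
  simp

lemma IsHermitian.cfc_sub_cfc (hA : A.IsHermitian) (f g : ℝ → ℝ) :
    hA.cfc f - hA.cfc g = hA.cfc (fun x => f x - g x) := by
  simp only [IsHermitian.cfc, ← map_sub, diagonal_sub]
  congr 2
  ext i
  simp

lemma IsHermitian.trace_cfc (hA : A.IsHermitian) (f : ℝ → ℝ) :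
    (hA.cfc f).trace = ((∑ i, f (hA.eigenvalues i) : ℝ) : ℂ) := by
  rw [IsHermitian.cfc, Unitary.conjStarAlgAut_apply, trace_mul_cycle, Unitary.coe_star_mul_self,
    one_mul, trace_diagonal]
  simp

lemma IsHermitian.posSemidef_cfc (hA : A.IsHermitian) {f : ℝ → ℝ} (hf : ∀ x, 0 ≤ f x) :
    (hA.cfc f).PosSemidef := by
  rw [IsHermitian.cfc, Unitary.conjStarAlgAut_apply]
  refine PosSemidef.mul_mul_conjTranspose_same (posSemidef_diagonal_iff.mpr fun i => ?_) _
  simpa using hf _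

lemma PosSemidef.trace_proj_mul_re_le {P : Matrix m m ℂ} (hA : A.PosSemidef)
    (hP : P.IsHermitian) (hPP : P * P = P) : (P * A).trace.re ≤ A.trace.re := by
  have h := hA.trace_proj_mul_re_nonneg (P := 1 - P) (isHermitian_one.sub hP)
    (by simp [sub_mul, mul_sub, hPP])
  rw [sub_mul, one_mul, trace_sub, Complex.sub_re] at h
  linarith

end Matrix

open Matrix

variable {d : ℕ} {X Y P : Matrix (Fin d) (Fin d) ℂ}

/-- The positive spectral projection attains the trace of the positive part. -/
lemma exists_proj_trace_mul_eq_posPartTrace (hX : X.IsHermitian) :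
    ∃ (P : Matrix (Fin d) (Fin d) ℂ) (k : ℕ), P.IsHermitian ∧ P * P = P ∧
      (P * X).trace.re = posPartTrace X ∧ P.trace.re = k ∧ (k = 0 → posPartTrace X = 0) := by
  set f : ℝ → ℝ := fun x => if 0 < x then 1 else 0 with hf
  have htr : (hX.cfc f * X).trace.re = posPartTrace X := by
    have h : hX.cfc f * X = hX.cfc (fun x => f x * x) := by
      rw [← hX.cfc_mul_cfc, hX.cfc_id_eq]
    rw [h, hX.trace_cfc, Complex.ofReal_re, posPartTrace, dif_pos hX]
    refine Finset.sum_congr rfl fun i _ => ?_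
    simp only [hf]
    split_ifs with h
    · rw [max_eq_left h.le, one_mul]
    · rw [max_eq_right (not_lt.mp h), zero_mul]
  refine ⟨hX.cfc f, (Finset.univ.filter fun i => 0 < hX.eigenvalues i).card,
    (hX.posSemidef_cfc fun x => ?_).isHermitian, ?_, htr, ?_, fun h0 => ?_⟩
  · simp only [hf]
    split_ifs <;> simp
  · rw [hX.cfc_mul_cfc]
    congr 1
    ext x
    simp [hf]
  · rw [hX.trace_cfc, Complex.ofReal_re]
    simp [hf]
  · rw [posPartTrace, dif_pos hX]
    rw [Finset.card_eq_zero, Finset.filter_eq_empty_iff] at h0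
    exact Finset.sum_eq_zero fun i hi => max_eq_right (not_lt.mp (h0 hi))

/-- The positive part of a Hermitian matrix is a positive semidefinite upper bound. -/
lemma exists_posSemidef_majorant (hY : Y.IsHermitian) :
    ∃ Q : Matrix (Fin d) (Fin d) ℂ, Q.PosSemidef ∧ (Q - Y).PosSemidef ∧
      Q.trace.re = posPartTrace Y := by
  refine ⟨hY.cfc (fun x => max x 0), hY.posSemidef_cfc fun x => le_max_right _ _, ?_, ?_⟩
  · have h : hY.cfc (fun x => max x 0) - Y = hY.cfc (fun x => max x 0 - x) := by
      rw [← hY.cfc_sub_cfc, hY.cfc_id_eq]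
    rw [h]
    exact hY.posSemidef_cfc fun x => sub_nonneg.mpr (le_max_left _ _)
  · rw [hY.trace_cfc, Complex.ofReal_re, posPartTrace, dif_pos hY]

/-- Data processing: testing the image of `Y` under a positive trace-preserving map with a
projection gives at most the trace of the positive part of `Y`. -/
lemma trace_proj_mul_map_le_posPartTrace
    {M : Matrix (Fin d) (Fin d) ℂ →ₗ[ℂ] Matrix (Fin d) (Fin d) ℂ}
    (hMpos : ∀ X : Matrix (Fin d) (Fin d) ℂ, X.PosSemidef → (M X).PosSemidef)
    (hMtp : ∀ X : Matrix (Fin d) (Fin d) ℂ, (M X).trace = X.trace)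
    (hP : P.IsHermitian) (hPP : P * P = P) (hY : Y.IsHermitian) :
    (P * M Y).trace.re ≤ posPartTrace Y := by
  obtain ⟨Q, hQ, hQY, hQtr⟩ := exists_posSemidef_majorant hY
  have h₁ := (hMpos _ hQY).trace_proj_mul_re_nonneg hP hPP
  have h₂ := (hMpos _ hQ).trace_proj_mul_re_le hP hPP
  rw [map_sub, mul_sub, trace_sub, Complex.sub_re] at h₁
  rw [hMtp, hQtr] at h₂
  linarith

lemma posPartTrace_eq_half_traceNorm (hX : X.IsHermitian) (htr : X.trace = 0) :
    posPartTrace X = 1 / 2 * traceNorm X := by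
  have h : ∑ i, hX.eigenvalues i = 0 := by
    have h := hX.trace_cfc (fun x => x)
    rw [hX.cfc_id_eq, htr] at h
    exact_mod_cast h.symm
  rw [posPartTrace, dif_pos hX, traceNorm, dif_pos hX]
  calc ∑ i, max (hX.eigenvalues i) 0
      = ∑ i, (1 / 2 * |hX.eigenvalues i| + 1 / 2 * hX.eigenvalues i) := by
        refine Finset.sum_congr rfl fun i _ => ?_
        rcases le_total 0 (hX.eigenvalues i) with h | h
        · rw [max_eq_left h, abs_of_nonneg h]; ring
        · rw [max_eq_right h, abs_of_nonpos h]; ring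
    _ = 1 / 2 * ∑ i, |hX.eigenvalues i| := by
        rw [Finset.sum_add_distrib, ← Finset.mul_sum, ← Finset.mul_sum, h, mul_zero, add_zero]

lemma Matrix.IsHermitian.realSmul {m : Type*} {X : Matrix m m ℂ} (hX : X.IsHermitian) (r : ℝ) :
    ((r : ℂ) • X).IsHermitian := by
  rw [IsHermitian, conjTranspose_smul, hX.eq]
  simp

/-- Differential privacy of generalized depolarizing channels with respect to
τ-neighbouring states. -/
theorem genDepol_differential_privacy_tau_neighbouring {n : ℕ}
    (M : Matrix (Fin (2 ^ n)) (Fin (2 ^ n)) ℂ →ₗ[ℂ] Matrix (Fin (2 ^ n)) (Fin (2 ^ n)) ℂ)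
    (hMpos : ∀ X : Matrix (Fin (2 ^ n)) (Fin (2 ^ n)) ℂ, X.PosSemidef → (M X).PosSemidef)
    (hMunital : M 1 = 1)
    (hMtp : ∀ X : Matrix (Fin (2 ^ n)) (Fin (2 ^ n)) ℂ, (M X).trace = X.trace)
    (p : ℝ) (hp0 : 0 ≤ p) (hp1 : p < 1)
    (ε τ : ℝ) (hε : 0 ≤ ε)
    (ρ σ : Matrix (Fin (2 ^ n)) (Fin (2 ^ n)) ℂ)
    (hρ : IsDensityMatrix ρ) (hσ : IsDensityMatrix σ)
    (hneighbour : (1 / 2) * traceNorm (ρ - σ) ≤ τ) :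
    hsDiv (Real.exp ε) (genDepol p M ρ) (genDepol p M σ)
        ≤ max 0 ((1 - Real.exp ε) * p / 2 ^ n + (1 - p) * τ) ∧
      (∀ γ β η : ℝ, γ = 1 + (Real.exp ε - 1) / (1 - p) → β = Real.exp ε / γ →
        hsDiv γ ρ (maxMixed (2 ^ n)) ≤ η →
        hsDiv (Real.exp ε) (genDepol p M ρ) (genDepol p M σ)
          ≤ (1 - p) * (1 - β) * η + (1 - p) * β * τ) := by
  have hτ : posPartTrace (ρ - σ) ≤ τ := by
    rwa [posPartTrace_eq_half_traceNorm (hρ.1.isHermitian.sub hσ.1.isHermitian)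
      (by rw [trace_sub, hρ.2, hσ.2, sub_self])]
  have hmm : (maxMixed (2 ^ n)).IsHermitian := by
    have h := (isHermitian_one (n := Fin (2 ^ n)) (α := ℂ)).realSmul (((2 ^ n : ℕ) : ℝ)⁻¹)
    simpa [maxMixed] using h
  have hMmm : M (maxMixed (2 ^ n)) = maxMixed (2 ^ n) := by
    rw [maxMixed, map_smul, hMunital]
  have he : 1 ≤ Real.exp ε := Real.one_le_exp hε
  have hgen (ω : Matrix (Fin (2 ^ n)) (Fin (2 ^ n)) ℂ) (hω : IsDensityMatrix ω) :
      genDepol p M ω = (p : ℂ) • maxMixed (2 ^ n) + ((1 - p : ℝ) : ℂ) • M ω := by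
    rw [genDepol, hω.2, mul_one]
  have hX : (genDepol p M ρ - (Real.exp ε : ℂ) • genDepol p M σ).IsHermitian := by
    rw [hgen ρ hρ, hgen σ hσ]
    exact ((hmm.realSmul _).add ((hMpos _ hρ.1).isHermitian.realSmul _)).sub
      (((hmm.realSmul _).add ((hMpos _ hσ.1).isHermitian.realSmul _)).realSmul _)
  obtain ⟨P, k, hP, hPP, hPX, hPtr, hk⟩ := exists_proj_trace_mul_eq_posPartTrace hX
  have hdiff : (P * M ρ).trace.re - (P * M σ).trace.re ≤ τ := by
    have h := trace_proj_mul_map_le_posPartTrace hMpos hMtp hP hPP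
      (hρ.1.isHermitian.sub hσ.1.isHermitian)
    rw [map_sub, mul_sub, trace_sub, Complex.sub_re] at h
    exact h.trans hτ
  have hσP : 0 ≤ (P * M σ).trace.re := (hMpos _ hσ.1).trace_proj_mul_re_nonneg hP hPP
  have hmmP : (P * maxMixed (2 ^ n)).trace.re = k / 2 ^ n := by
    have h : P * maxMixed (2 ^ n) = (((2 ^ n : ℝ)⁻¹ : ℝ) : ℂ) • P := by
      simp [maxMixed]
    rw [h, trace_smul, smul_eq_mul, Complex.re_ofReal_mul, hPtr]
    ring
  have hval : hsDiv (Real.exp ε) (genDepol p M ρ) (genDepol p M σ)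
      = (1 - Real.exp ε) * p * (k / 2 ^ n)
        + (1 - p) * ((P * M ρ).trace.re - Real.exp ε * (P * M σ).trace.re) := by
    rw [hsDiv, ← hPX, hgen ρ hρ, hgen σ hσ]
    simp only [mul_sub, mul_add, Matrix.mul_smul, trace_sub, trace_add, trace_smul, smul_eq_mul,
      Complex.sub_re, Complex.add_re, Complex.re_ofReal_mul, hmmP]
    ring
  constructor
  · rcases Nat.eq_zero_or_pos k with h0 | hpos
    · rw [hsDiv, hk h0]
      exact le_max_left _ _
    · refine le_trans ?_ (le_max_right _ _)
      have hk1 : (1 : ℝ) ≤ k := by exact_mod_cast hpos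
      have h₁ : (1 - Real.exp ε) * p * (k / 2 ^ n) ≤ (1 - Real.exp ε) * p / 2 ^ n := by
        rw [← mul_div_assoc]
        refine div_le_div_of_nonneg_right ?_ (by positivity)
        nlinarith [mul_nonneg (mul_nonneg (sub_nonneg.mpr he) hp0) (sub_nonneg.mpr hk1)]
      have h₂ : (P * M ρ).trace.re - Real.exp ε * (P * M σ).trace.re ≤ τ := by
        nlinarith
      rw [hval]
      exact add_le_add h₁ (mul_le_mul_of_nonneg_left h₂ (sub_nonneg.mpr hp1.le))
  · intro γ β η hγ hβ hη
    have hq : 0 < 1 - p := sub_pos.mpr hp1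
    have hγp : (1 - p) * γ = Real.exp ε - p := by
      rw [hγ]
      field_simp
      ring
    have hγe : Real.exp ε ≤ γ := by
      refine le_of_mul_le_mul_left ?_ hq
      nlinarith
    have hγ0 : 0 < γ := (Real.exp_pos ε).trans_le hγe
    have hγβ : γ * β = Real.exp ε := by
      rw [hβ]
      field_simp
    have hβ0 : 0 ≤ β := by
      rw [hβ]
      positivity
    have hβ1 : β ≤ 1 := by
      rw [hβ]
      exact (div_le_one hγ0).mpr hγe
    have hηP : (P * M ρ).trace.re - γ * (k / 2 ^ n) ≤ η := by
      have h := trace_proj_mul_map_le_posPartTrace hMpos hMtp hP hPP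
        (hρ.1.isHermitian.sub (hmm.realSmul γ))
      rw [map_sub, map_smul, hMmm, mul_sub, Matrix.mul_smul, trace_sub, trace_smul, smul_eq_mul,
        Complex.sub_re, Complex.re_ofReal_mul, hmmP] at h
      exact h.trans hη
    have hγσ : (P * M ρ).trace.re - γ * (P * M σ).trace.re ≤ τ := by
      nlinarith
    calc hsDiv (Real.exp ε) (genDepol p M ρ) (genDepol p M σ)
        = (1 - p) * (1 - β) * ((P * M ρ).trace.re - γ * (k / 2 ^ n))
          + (1 - p) * β * ((P * M ρ).trace.re - γ * (P * M σ).trace.re) := by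
          rw [hval]
          linear_combination (k / 2 ^ n : ℝ) * hγp
            + ((1 - p) * (P * M σ).trace.re - (1 - p) * (k / 2 ^ n)) * hγβ
      _ ≤ (1 - p) * (1 - β) * η + (1 - p) * β * τ :=
          add_le_add
            (mul_le_mul_of_nonneg_left hηP (mul_nonneg hq.le (sub_nonneg.mpr hβ1)))
            (mul_le_mul_of_nonneg_left hγσ (mul_nonneg hq.le hβ0))
end

section
/- Privacy amplification by bounded total variation (classical core of post-processing privacy): let X be a finite set and let ν, ν' be probability measures on X with TV(ν, ν') ≤ τ, where 0 ≤ τ ≤ 1. Let Λ be a kernel assigning to each x ∈ X a probability measure Λ(x) on a measurable space Y, and suppose that for all x, x' ∈ X and ε ≥ 0, δ ≥ 0 one has E_{e^ε}(Λ(x)‖Λ(x')) ≤ δ. Then, writing Λ(ν) for the mixture measure S ↦ Σ_{x∈X} ν({x})·Λ(x)(S), one has E_{e^{ε'}}(Λ(ν)‖Λ(ν')) ≤ τ·δ, where ε' = log(1 + τ·(e^ε − 1)). -/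
open MeasureTheory

/-- The classical hockey-stick divergence
`E_γ(μ‖ν) := sup over measurable sets S of (μ(S) − γ·ν(S))`. -/
noncomputable def classicalHS {Y : Type*} [MeasurableSpace Y]
    (γ : ℝ) (μ ν : Measure Y) : ℝ :=
  ⨆ S : {S : Set Y // MeasurableSet S}, ((μ S.1).toReal - γ * (ν S.1).toReal)

/-- A single measurable set gives a lower bound for the hockey-stick divergence. -/
lemma sub_le_classicalHS {Y : Type*} [MeasurableSpace Y] {γ : ℝ} (hγ : 0 ≤ γ)
    (μ ν : Measure Y) [IsFiniteMeasure μ] {S : Set Y} (hS : MeasurableSet S) :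
    μ.real S - γ * ν.real S ≤ classicalHS γ μ ν := by
  refine le_ciSup (f := fun S : {S : Set Y // MeasurableSet S} =>
    (μ S.1).toReal - γ * (ν S.1).toReal) ⟨μ.real Set.univ, ?_⟩ ⟨S, hS⟩
  rintro _ ⟨T, rfl⟩
  have h₁ : μ.real T.1 ≤ μ.real Set.univ := measureReal_mono (Set.subset_univ _)
  have h₂ : 0 ≤ γ * ν.real T.1 := mul_nonneg hγ measureReal_nonneg
  simp only [measureReal_def] at h₁ h₂ ⊢
  linarith

lemma measureReal_sum_ofReal_smul {X Y : Type*} [Fintype X] [MeasurableSpace Y]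
    {w : X → ℝ} (hw : ∀ x, 0 ≤ w x) (Λ : X → Measure Y) [∀ x, IsFiniteMeasure (Λ x)]
    (S : Set Y) :
    (∑ x, ENNReal.ofReal (w x) • Λ x).real S = ∑ x, w x * (Λ x).real S := by
  rw [measureReal_def, Measure.finsetSum_apply, ENNReal.toReal_sum]
  · simp [measureReal_def, ENNReal.toReal_ofReal (hw _)]
  · intro x _
    exact ENNReal.mul_ne_top ENNReal.ofReal_ne_top (measure_ne_top _ _)

/-- The expectations of a function with values in `[m, M]` under two weights of equal mass
differ by at most `M - m` times their total variation distance. -/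
lemma sum_mul_sub_sum_mul_le {X : Type*} [Fintype X] {ν ν' f : X → ℝ} {τ m M : ℝ}
    (hmass : ∑ x, ν x = ∑ x, ν' x)
    (hTV : ∀ S : Finset X, ∑ x ∈ S, ν x - ∑ x ∈ S, ν' x ≤ τ)
    (hm : ∀ x, m ≤ f x) (hM : ∀ x, f x ≤ M) (hmM : m ≤ M) :
    ∑ x, ν x * f x - ∑ x, ν' x * f x ≤ τ * (M - m) := by
  classical
  have hcenter : ∑ x, ν x * f x - ∑ x, ν' x * f x = ∑ x, (ν x - ν' x) * (f x - m) := by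
    simp only [sub_mul, mul_sub, Finset.sum_sub_distrib, ← Finset.sum_mul, hmass]
    ring
  calc ∑ x, ν x * f x - ∑ x, ν' x * f x
      = ∑ x, (ν x - ν' x) * (f x - m) := hcenter
    _ ≤ ∑ x, if ν' x ≤ ν x then (ν x - ν' x) * (M - m) else 0 := by
        refine Finset.sum_le_sum fun x _ => ?_
        split_ifs with h
        · exact mul_le_mul_of_nonneg_left (by linarith [hM x]) (by linarith)
        · exact mul_nonpos_of_nonpos_of_nonneg (by linarith) (by linarith [hm x])
    _ = (∑ x with ν' x ≤ ν x, ν x - ∑ x with ν' x ≤ ν x, ν' x) * (M - m) := by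
        rw [← Finset.sum_filter, ← Finset.sum_mul, Finset.sum_sub_distrib]
    _ ≤ τ * (M - m) := mul_le_mul_of_nonneg_right (hTV _) (by linarith)

/-- Privacy amplification by bounded total variation (classical core of
post-processing privacy). -/
theorem privacy_amplification_bounded_tv
    {X Y : Type*} [Fintype X] [MeasurableSpace Y]
    (ν ν' : X → ℝ)
    (hν0 : ∀ x, 0 ≤ ν x) (hν1 : ∑ x, ν x = 1)
    (hν'0 : ∀ x, 0 ≤ ν' x) (hν'1 : ∑ x, ν' x = 1)
    (Λ : X → Measure Y) (hΛ : ∀ x, IsProbabilityMeasure (Λ x))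
    (τ : ℝ) (hτ0 : 0 ≤ τ) (hτ1 : τ ≤ 1)
    (hTV : ∀ S : Finset X, |∑ x ∈ S, ν x - ∑ x ∈ S, ν' x| ≤ τ)
    (ε δ : ℝ) (hε : 0 ≤ ε) (hδ : 0 ≤ δ)
    (hpriv : ∀ x x' : X, classicalHS (Real.exp ε) (Λ x) (Λ x') ≤ δ)
    (ε' : ℝ) (hε' : ε' = Real.log (1 + τ * (Real.exp ε - 1))) :
    classicalHS (Real.exp ε')
        (∑ x, ENNReal.ofReal (ν x) • Λ x)
        (∑ x, ENNReal.ofReal (ν' x) • Λ x) ≤ τ * δ := by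
  have hγ : 1 ≤ Real.exp ε := Real.one_le_exp hε
  have hγ' : Real.exp ε' = 1 + τ * (Real.exp ε - 1) := by
    rw [hε', Real.exp_log]
    nlinarith
  have : Nonempty X := by
    by_contra h
    rw [not_nonempty_iff] at h
    simp at hν1
  refine ciSup_le fun ⟨S, hS⟩ => ?_
  simp only [← measureReal_def]
  rw [measureReal_sum_ofReal_smul hν0, measureReal_sum_ofReal_smul hν'0, hγ']
  obtain ⟨a, ha⟩ := Finite.exists_max fun x => (Λ x).real S
  obtain ⟨b, hb⟩ := Finite.exists_min fun x => (Λ x).real S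
  have hab : (Λ a).real S - Real.exp ε * (Λ b).real S ≤ δ :=
    (sub_le_classicalHS (by linarith) (Λ a) (Λ b) hS).trans (hpriv a b)
  have hdiff := sum_mul_sub_sum_mul_le (hν1.trans hν'1.symm)
    (fun T => (le_abs_self _).trans (hTV T)) hb ha (ha b)
  have hmin : (Λ b).real S ≤ ∑ x, ν' x * (Λ x).real S := by
    calc (Λ b).real S = ∑ x, ν' x * (Λ b).real S := by rw [← Finset.sum_mul, hν'1, one_mul]
      _ ≤ _ := Finset.sum_le_sum fun x _ => mul_le_mul_of_nonneg_left (hb x) (hν'0 x)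
  have hscaled := mul_le_mul_of_nonneg_left hmin (mul_nonneg hτ0 (sub_nonneg.2 hγ))
  have hpriv_scaled := mul_le_mul_of_nonneg_left hab hτ0
  linarith
end

section
/- Laplace mechanism on quantum measurement outcomes: let (M_i)_{i∈ι} be a finite POVM on ℂ^d (each M_i positive semidefinite and Σ_i M_i = I) with outcome values v : ι → ℝ satisfying v(i) ∈ [a, a+Δ] for all i, and let b > 0. For a density matrix ρ, define the output probability measure on ℝ by μ_ρ(S) := Σ_i Tr[M_i ρ] · Lap_b(v(i))(S), where Lap_b(x) is the measure with Lebesgue density y ↦ (1/(2b))·exp(−|y−x|/b). Then for all density matrices ρ, σ with (1/2)·‖ρ − σ‖₁ ≤ τ (0 ≤ τ ≤ 1) and all Borel sets S ⊆ ℝ: μ_ρ(S) ≤ e^{ε'}·μ_σ(S), where ε' = log(1 + τ·(e^{Δ/b} − 1)). -/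
open MeasureTheory
open scoped ComplexOrder

/-- The Laplace distribution on ℝ centred at `x` with scale `b`, given by the
Lebesgue density `y ↦ (1/(2b))·exp(−|y−x|/b)`. -/
noncomputable def laplaceMeasure (b x : ℝ) : Measure ℝ :=
  volume.withDensity (fun y => ENNReal.ofReal ((1 / (2 * b)) * Real.exp (-|y - x| / b)))

/-- Densities of Laplace distributions with nearby centres are comparable, hence so are the
measures. -/
theorem laplaceMeasure_apply_le {b Δ x y : ℝ} (hb : 0 < b) (hxy : |x - y| ≤ Δ) (S : Set ℝ)
    (hS : MeasurableSet S) :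
    laplaceMeasure b x S ≤ ENNReal.ofReal (Real.exp (Δ / b)) * laplaceMeasure b y S := by
  rw [laplaceMeasure, laplaceMeasure, withDensity_apply _ hS, withDensity_apply _ hS,
    ← lintegral_const_mul' _ _ ENNReal.ofReal_ne_top]
  refine lintegral_mono fun z => ?_
  rw [← ENNReal.ofReal_mul (Real.exp_pos _).le]
  refine ENNReal.ofReal_le_ofReal ?_
  rw [mul_left_comm, ← Real.exp_add, ← add_div]
  have h : |z - y| ≤ |z - x| + |x - y| := abs_sub_le z x y
  gcongr
  linarith

/-- Real-valued form of `laplaceMeasure_apply_le`. -/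
theorem laplaceMeasure_toReal_le {b Δ x y : ℝ} (hb : 0 < b) (hxy : |x - y| ≤ Δ) (S : Set ℝ)
    (hS : MeasurableSet S) :
    (laplaceMeasure b x S).toReal ≤ Real.exp (Δ / b) * (laplaceMeasure b y S).toReal := by
  by_cases hy : laplaceMeasure b y S = ⊤
  · have h := laplaceMeasure_apply_le hb (abs_sub_comm x y ▸ hxy) S hS
    have hx : laplaceMeasure b x S = ⊤ := by
      by_contra hx
      exact (ENNReal.mul_lt_top ENNReal.ofReal_lt_top (lt_top_iff_ne_top.2 hx)).not_ge (hy ▸ h)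
    simp [hx, hy]
  · have h := ENNReal.toReal_mono (ENNReal.mul_ne_top ENNReal.ofReal_ne_top hy)
      (laplaceMeasure_apply_le hb hxy S hS)
    rwa [ENNReal.toReal_mul, ENNReal.toReal_ofReal (Real.exp_pos _).le] at h

/-- Measuring a Hermitian matrix with a finite POVM yields a vector whose `ℓ¹` norm is at most
the trace norm. -/
theorem sum_abs_re_trace_mul_le_traceNorm {d : ℕ} {ι : Type*} [Fintype ι]
    (M : ι → Matrix (Fin d) (Fin d) ℂ) (hMpos : ∀ i, (M i).PosSemidef) (hMsum : ∑ i, M i = 1)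
    {X : Matrix (Fin d) (Fin d) ℂ} (hX : X.IsHermitian) :
    ∑ i, |((M i * X).trace).re| ≤ traceNorm X := by
  obtain ⟨U, hU⟩ : ∃ U : Matrix (Fin d) (Fin d) ℂ, U = hX.eigenvectorUnitary := ⟨_, rfl⟩
  have hUU : U.conjTranspose * U = 1 := by
    rw [hU]; exact Unitary.coe_star_mul_self hX.eigenvectorUnitary
  have hXU : X = U * Matrix.diagonal (fun k => (hX.eigenvalues k : ℂ)) * U.conjTranspose := by
    have h := hX.spectral_theorem
    rw [Unitary.conjStarAlgAut_apply, ← hU] at h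
    exact h
  let N : ι → Matrix (Fin d) (Fin d) ℂ := fun i => U.conjTranspose * M i * U
  have hN : ∀ i k, 0 ≤ (N i k k).re := fun i k =>
    (Complex.le_def.1 ((hMpos i).conjTranspose_mul_mul_same U).diag_nonneg).1
  have hNsum : ∀ k, ∑ i, (N i k k).re = 1 := fun k => by
    have h : ∑ i, N i = 1 := by
      simp only [N]
      rw [← Finset.sum_mul, ← Finset.mul_sum, hMsum, mul_one, hUU]
    have hk := congrArg (fun A : Matrix (Fin d) (Fin d) ℂ => (A k k).re) h
    simpa [Matrix.sum_apply] using hk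
  have htr : ∀ i, ((M i * X).trace).re = ∑ k, (N i k k).re * hX.eigenvalues k := fun i => by
    have h : (M i * X).trace
        = (N i * Matrix.diagonal (fun k => (hX.eigenvalues k : ℂ))).trace := by
      conv_lhs => rw [hXU, ← mul_assoc, Matrix.trace_mul_comm]
      simp only [N, mul_assoc]
    rw [h, Matrix.trace]
    simp [Matrix.mul_diagonal]
  calc ∑ i, |((M i * X).trace).re|
      ≤ ∑ i, ∑ k, (N i k k).re * |hX.eigenvalues k| := by
        refine Finset.sum_le_sum fun i _ => ?_
        rw [htr]
        refine (Finset.abs_sum_le_sum_abs _ _).trans_eq (Finset.sum_congr rfl fun k _ => ?_)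
        rw [abs_mul, abs_of_nonneg (hN i k)]
    _ = traceNorm X := by
        rw [Finset.sum_comm, traceNorm, dif_pos hX]
        simp [← Finset.sum_mul, hNsum]

/-- The outcome probabilities of a POVM sum to the trace of the measured matrix. -/
theorem sum_re_trace_mul {d : ℕ} {ι : Type*} [Fintype ι]
    (M : ι → Matrix (Fin d) (Fin d) ℂ) (hMsum : ∑ i, M i = 1) (ρ : Matrix (Fin d) (Fin d) ℂ) :
    ∑ i, ((M i * ρ).trace).re = ρ.trace.re := by
  rw [← Complex.re_sum, ← Matrix.trace_sum, ← Finset.sum_mul, hMsum, one_mul]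

open scoped MatrixOrder Matrix.Norms.L2Operator in
/-- The trace of a product of positive semidefinite matrices has nonnegative real part. -/
theorem re_trace_mul_nonneg {d : ℕ} {A B : Matrix (Fin d) (Fin d) ℂ}
    (hA : A.PosSemidef) (hB : B.PosSemidef) : 0 ≤ ((A * B).trace).re := by
  obtain ⟨C, rfl⟩ := CStarAlgebra.nonneg_iff_eq_star_mul_self.mp hB.nonneg
  rw [← mul_assoc, Matrix.trace_mul_comm, ← mul_assoc]
  exact (Complex.le_def.1 (hA.mul_mul_conjTranspose_same C).trace_nonneg).1

/-- Expectations of a function with range in `[m, K * m]` under two probability vectors within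
`ℓ¹` distance `2 * τ`. -/
theorem sum_mul_le_of_l1_close {ι : Type*} [Fintype ι] {p q x : ι → ℝ} {m K τ : ℝ}
    (hq : ∀ i, 0 ≤ q i) (hp1 : ∑ i, p i = 1) (hq1 : ∑ i, q i = 1)
    (hpq : ∑ i, |p i - q i| ≤ 2 * τ) (hτ : 0 ≤ τ) (hm : 0 ≤ m) (hK : 1 ≤ K)
    (hmx : ∀ i, m ≤ x i) (hxK : ∀ i, x i ≤ K * m) :
    ∑ i, p i * x i ≤ (1 + τ * (K - 1)) * ∑ i, q i * x i := by
  have hdiff : ∑ i, p i * x i - ∑ i, q i * x i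
      = ∑ i, (p i - q i) * (x i - (K + 1) * m / 2) := by
    have h : ∀ i, (p i - q i) * (x i - (K + 1) * m / 2)
        = p i * x i - q i * x i - (p i - q i) * ((K + 1) * m / 2) := fun i => by ring
    simp only [h, Finset.sum_sub_distrib, ← Finset.sum_mul, hp1, hq1]
    ring
  have hbound : ∑ i, (p i - q i) * (x i - (K + 1) * m / 2)
      ≤ (∑ i, |p i - q i|) * ((K - 1) * m / 2) := by
    rw [Finset.sum_mul]
    refine Finset.sum_le_sum fun i _ => (le_abs_self _).trans ?_
    rw [abs_mul]
    refine mul_le_mul_of_nonneg_left (abs_le.2 ⟨?_, ?_⟩) (abs_nonneg _)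
    · linarith [hmx i]
    · linarith [hxK i]
  have hmq : m ≤ ∑ i, q i * x i := by
    calc m = ∑ i, q i * m := by rw [← Finset.sum_mul, hq1, one_mul]
      _ ≤ _ := Finset.sum_le_sum fun i _ => mul_le_mul_of_nonneg_left (hmx i) (hq i)
  have h1 := mul_le_mul_of_nonneg_right hpq
    (show 0 ≤ (K - 1) * m / 2 by have := sub_nonneg.2 hK; positivity)
  have h2 := mul_le_mul_of_nonneg_left hmq (mul_nonneg hτ (sub_nonneg.2 hK))
  linarith

/-- Laplace mechanism on quantum measurement outcomes. -/
theorem laplace_mechanism_quantum_measurement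
    {d : ℕ} {ι : Type*} [Fintype ι]
    (M : ι → Matrix (Fin d) (Fin d) ℂ)
    (hMpos : ∀ i, (M i).PosSemidef) (hMsum : ∑ i, M i = 1)
    (v : ι → ℝ) (a Δ : ℝ) (hv : ∀ i, v i ∈ Set.Icc a (a + Δ))
    (b : ℝ) (hb : 0 < b)
    (ρ σ : Matrix (Fin d) (Fin d) ℂ)
    (hρ : IsDensityMatrix ρ) (hσ : IsDensityMatrix σ)
    (τ : ℝ) (hτ0 : 0 ≤ τ) (hτ1 : τ ≤ 1)
    (hneighbour : (1 / 2) * traceNorm (ρ - σ) ≤ τ)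
    (ε' : ℝ) (hε' : ε' = Real.log (1 + τ * (Real.exp (Δ / b) - 1)))
    (S : Set ℝ) (hS : MeasurableSet S) :
    ∑ i, ((M i * ρ).trace).re * (laplaceMeasure b (v i) S).toReal
      ≤ Real.exp ε' * ∑ i, ((M i * σ).trace).re * (laplaceMeasure b (v i) S).toReal := by
  rcases isEmpty_or_nonempty ι with _ | _
  · simp
  have hdist : ∀ i j, |v i - v j| ≤ Δ := fun i j => by
    obtain ⟨hi1, hi2⟩ := hv i
    obtain ⟨hj1, hj2⟩ := hv j
    exact abs_le.2 ⟨by linarith, by linarith⟩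
  have hΔ : 0 ≤ Δ := (abs_nonneg _).trans (hdist (Classical.arbitrary ι) (Classical.arbitrary ι))
  have hK : 1 ≤ Real.exp (Δ / b) := Real.one_le_exp (div_nonneg hΔ hb.le)
  obtain ⟨j, hj⟩ := Finite.exists_min fun i => (laplaceMeasure b (v i) S).toReal
  have hpos : 0 < 1 + τ * (Real.exp (Δ / b) - 1) := by
    have := mul_nonneg hτ0 (sub_nonneg.2 hK)
    linarith
  rw [hε', Real.exp_log hpos]
  refine sum_mul_le_of_l1_close (fun i => re_trace_mul_nonneg (hMpos i) hσ.1) ?_ ?_ ?_ hτ0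
    ENNReal.toReal_nonneg hK hj fun i => laplaceMeasure_toReal_le hb (hdist i j) S hS
  · rw [sum_re_trace_mul M hMsum, hρ.2, Complex.one_re]
  · rw [sum_re_trace_mul M hMsum, hσ.2, Complex.one_re]
  · have h := sum_abs_re_trace_mul_le_traceNorm M hMpos hMsum (hρ.1.isHermitian.sub hσ.1.isHermitian)
    simp only [mul_sub, Matrix.trace_sub, Complex.sub_re] at h
    linarith
end

section
/- Total variation bound for quantum-inspired sampling: let u, u' ∈ ℂ^N be nonzero vectors that agree in all coordinates except possibly coordinate j (i.e. u_i = u'_i for all i ≠ j). Define the probability distributions p_u(i) := |u_i|²/‖u‖₂² and p_{u'}(i) := |u'_i|²/‖u'‖₂² on {1,…,N}. Then (1/2)·Σ_{i=1}^N |p_u(i) − p_{u'}(i)| ≤ (3/2)·max{ |u_j|²/‖u‖₂², |u'_j|²/‖u'‖₂² }. -/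
/-- If nonnegative weights `f` and weights `g`, with nonzero totals, agree away from `j`, then the
`ℓ¹` distance between their normalizations is twice the difference at `j`. -/
theorem sum_abs_div_sub_div_of_agree_off {ι : Type*} [Fintype ι] [DecidableEq ι]
    {f g : ι → ℝ} (hf : ∀ i, 0 ≤ f i) {S T : ℝ} (hS : ∑ i, f i = S) (hT : ∑ i, g i = T)
    (hS0 : S ≠ 0) (hT0 : T ≠ 0) (j : ι) (h : ∀ i, i ≠ j → f i = g i) :
    ∑ i, |f i / S - g i / T| = 2 * |f j / S - g j / T| := by
  rw [← Finset.add_sum_erase _ _ (Finset.mem_univ j)] at hS hT ⊢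
  have hfg : ∑ i ∈ Finset.univ.erase j, g i = ∑ i ∈ Finset.univ.erase j, f i :=
    Finset.sum_congr rfl fun i hi => (h i (Finset.ne_of_mem_erase hi)).symm
  have hoff : ∑ i ∈ Finset.univ.erase j, |f i / S - g i / T|
      = (∑ i ∈ Finset.univ.erase j, f i) * |1 / S - 1 / T| := by
    rw [Finset.sum_mul]
    refine Finset.sum_congr rfl fun i hi => ?_
    rw [← h i (Finset.ne_of_mem_erase hi), ← abs_of_nonneg (hf i), ← abs_mul,
      abs_of_nonneg (hf i)]
    congr 1
    ring
  have hR : 0 ≤ ∑ i ∈ Finset.univ.erase j, f i := Finset.sum_nonneg fun i _ => hf i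
  rw [hoff]
  rw [hfg] at hT
  generalize ∑ i ∈ Finset.univ.erase j, f i = R at *
  have hkey : R * (1 / S - 1 / T) = -(f j / S - g j / T) := by
    have h1 : f j / S + R / S = 1 := by rw [← add_div, hS, div_self hS0]
    have h2 : g j / T + R / T = 1 := by rw [← add_div, hT, div_self hT0]
    linear_combination h1 - h2
  have habs : R * |1 / S - 1 / T| = |f j / S - g j / T| := by
    rw [← abs_neg (f j / S - g j / T), ← hkey, abs_mul, abs_of_nonneg hR]
  rw [habs]
  ring

/-- Total variation bound for quantum-inspired sampling: if two nonzero vectors agree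
in all coordinates except possibly coordinate `j`, the induced sampling distributions
`p_u(i) = |u_i|²/‖u‖₂²` are within total variation distance
`(3/2)·max{|u_j|²/‖u‖₂², |u'_j|²/‖u'‖₂²}`. -/
theorem tv_bound_quantum_inspired_sampling {N : ℕ}
    (u u' : EuclideanSpace ℂ (Fin N)) (hu : u ≠ 0) (hu' : u' ≠ 0)
    (j : Fin N) (hagree : ∀ i, i ≠ j → u i = u' i) :
    (1 / 2) * ∑ i, |‖u i‖ ^ 2 / ‖u‖ ^ 2 - ‖u' i‖ ^ 2 / ‖u'‖ ^ 2|
      ≤ (3 / 2) * max (‖u j‖ ^ 2 / ‖u‖ ^ 2) (‖u' j‖ ^ 2 / ‖u'‖ ^ 2) := by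
  have hnu : ‖u‖ ^ 2 ≠ 0 := pow_ne_zero 2 (norm_ne_zero_iff.mpr hu)
  have hnu' : ‖u'‖ ^ 2 ≠ 0 := pow_ne_zero 2 (norm_ne_zero_iff.mpr hu')
  rw [sum_abs_div_sub_div_of_agree_off (f := fun i => ‖u i‖ ^ 2) (g := fun i => ‖u' i‖ ^ 2)
    (fun i => sq_nonneg _) (EuclideanSpace.norm_sq_eq u).symm (EuclideanSpace.norm_sq_eq u').symm
    hnu hnu' j (fun i hi => by simp only [hagree i hi])]
  have ha : 0 ≤ ‖u j‖ ^ 2 / ‖u‖ ^ 2 := by positivity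
  have hb : 0 ≤ ‖u' j‖ ^ 2 / ‖u'‖ ^ 2 := by positivity
  have hla := le_max_left (‖u j‖ ^ 2 / ‖u‖ ^ 2) (‖u' j‖ ^ 2 / ‖u'‖ ^ 2)
  have hlb := le_max_right (‖u j‖ ^ 2 / ‖u‖ ^ 2) (‖u' j‖ ^ 2 / ‖u'‖ ^ 2)
  have habs : |‖u j‖ ^ 2 / ‖u‖ ^ 2 - ‖u' j‖ ^ 2 / ‖u'‖ ^ 2|
      ≤ max (‖u j‖ ^ 2 / ‖u‖ ^ 2) (‖u' j‖ ^ 2 / ‖u'‖ ^ 2) :=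
    abs_le.mpr ⟨by linarith, by linarith⟩
  linarith
end

section
/- No-go for pure differential privacy under the quantum Wasserstein-1 distance: let n ≥ 1 and let A be a linear map on 2^n × 2^n complex matrices mapping density matrices to density matrices. Suppose that for all density matrices ρ, σ and every positive semidefinite matrix M with M ≤ I, one has Tr[M · A((1 − 1/n)·ρ + (1/n)·σ)] ≤ e^ε · Tr[M · A(ρ)] (this is the ε-differential-privacy condition applied to the pair ρ and ρ' = (1−1/n)ρ + (1/n)σ, which are at quantum W₁ distance at most 1). Then for all density matrices ρ, σ and all such M: Tr[M · A(σ)] ≤ e^ε·(n − e^{−ε}·(n−1)) · Tr[M · A(ρ)]. -/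
open scoped ComplexOrder

/-- No-go for pure differential privacy under the quantum Wasserstein-1 distance. -/
theorem no_go_pure_DP_wasserstein_one {n : ℕ} (hn : 1 ≤ n)
    (A : Matrix (Fin (2 ^ n)) (Fin (2 ^ n)) ℂ →ₗ[ℂ] Matrix (Fin (2 ^ n)) (Fin (2 ^ n)) ℂ)
    (hAstates : ∀ ρ : Matrix (Fin (2 ^ n)) (Fin (2 ^ n)) ℂ,
      ρ.PosSemidef → ρ.trace = 1 → (A ρ).PosSemidef ∧ (A ρ).trace = 1)
    (ε : ℝ)
    (hpriv : ∀ ρ σ : Matrix (Fin (2 ^ n)) (Fin (2 ^ n)) ℂ,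
      ρ.PosSemidef → ρ.trace = 1 → σ.PosSemidef → σ.trace = 1 →
      ∀ M : Matrix (Fin (2 ^ n)) (Fin (2 ^ n)) ℂ,
        M.PosSemidef → (1 - M).PosSemidef →
        ((M * A (((1 - 1 / (n : ℝ) : ℝ) : ℂ) • ρ + ((1 / (n : ℝ) : ℝ) : ℂ) • σ)).trace).re
          ≤ Real.exp ε * ((M * A ρ).trace).re) :
    ∀ ρ σ : Matrix (Fin (2 ^ n)) (Fin (2 ^ n)) ℂ,
      ρ.PosSemidef → ρ.trace = 1 → σ.PosSemidef → σ.trace = 1 →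
      ∀ M : Matrix (Fin (2 ^ n)) (Fin (2 ^ n)) ℂ,
        M.PosSemidef → (1 - M).PosSemidef →
        ((M * A σ).trace).re
          ≤ Real.exp ε * ((n : ℝ) - Real.exp (-ε) * ((n : ℝ) - 1)) * ((M * A ρ).trace).re := by
  intro ρ σ hρ hρ1 hσ hσ1 M hM hM1
  have h := hpriv ρ σ hρ hρ1 hσ hσ1 M hM hM1
  rw [map_add, map_smul, map_smul, Matrix.mul_add, Matrix.mul_smul, Matrix.mul_smul,
    Matrix.trace_add, Matrix.trace_smul, Matrix.trace_smul, Complex.add_re, smul_eq_mul,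
    smul_eq_mul, Complex.re_ofReal_mul, Complex.re_ofReal_mul] at h
  have hn0 : (0 : ℝ) < n := by exact_mod_cast hn
  have hexp : Real.exp ε * Real.exp (-ε) = 1 := by rw [← Real.exp_add]; simp
  generalize (M * A σ).trace.re = b at h ⊢
  generalize (M * A ρ).trace.re = a at h ⊢
  calc b = n * ((1 - 1 / (n : ℝ)) * a + 1 / (n : ℝ) * b) - (n - 1) * a := by
        field_simp
        ring
    _ ≤ n * (Real.exp ε * a) - (n - 1) * a := by gcongr
    _ = Real.exp ε * (n - Real.exp (-ε) * (n - 1)) * a := by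
        linear_combination (n - 1) * a * hexp
end

section
/- Parallel composition of differentially private measurements: let μ₁, ν₁ be probability measures on a measurable space X₁ and μ₂, ν₂ probability measures on a measurable space X₂. Suppose that for every measurable S₁ ⊆ X₁: μ₁(S₁) ≤ e^{ε₁}·ν₁(S₁) + δ₁, and for every measurable S₂ ⊆ X₂: μ₂(S₂) ≤ e^{ε₂}·ν₂(S₂) + δ₂, where ε₁, ε₂, δ₁, δ₂ ≥ 0. Then for every measurable set S ⊆ X₁ × X₂: (μ₁ × μ₂)(S) ≤ e^{ε₁+ε₂}·(ν₁ × ν₂)(S) + δ₁ + δ₂, where μ₁ × μ₂ denotes the product measure. -/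
open MeasureTheory

open scoped ENNReal

/-- A setwise comparison `μ ≤ c • ν + d` extends to measurable functions with values in
`[0, 1]`. -/
theorem lintegral_le_mul_lintegral_add_of_le_one {X : Type*} [MeasurableSpace X]
    {μ ν : Measure X} {c d : ℝ≥0∞}
    (h : ∀ S, MeasurableSet S → μ S ≤ c * ν S + d)
    {f : X → ℝ≥0∞} (hf : Measurable f) (hf1 : ∀ x, f x ≤ 1) :
    ∫⁻ x, f x ∂μ ≤ c * ∫⁻ x, f x ∂ν + d := by
  have layer (ρ : Measure X) :
      ∫⁻ x, f x ∂ρ = ∫⁻ t in Set.Ioi (0 : ℝ), ρ {x | t < (f x).toReal} := by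
    rw [← lintegral_eq_lintegral_meas_lt ρ (Filter.Eventually.of_forall fun _ =>
      ENNReal.toReal_nonneg) hf.ennreal_toReal.aemeasurable]
    exact lintegral_congr fun x =>
      (ENNReal.ofReal_toReal (ne_top_of_le_ne_top ENNReal.one_ne_top (hf1 x))).symm
  have hmeas : Measurable fun t : ℝ => ν {x | t < (f x).toReal} :=
    Antitone.measurable fun _ _ hst => measure_mono fun _ hx => hst.trans_lt hx
  rw [layer μ, layer ν]
  calc ∫⁻ t in Set.Ioi (0 : ℝ), μ {x | t < (f x).toReal}
      ≤ ∫⁻ t in Set.Ioi (0 : ℝ), (c * ν {x | t < (f x).toReal} +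
          (Set.Iio (1 : ℝ)).indicator (fun _ => d) t) := by
        refine lintegral_mono fun t => ?_
        by_cases ht : t < 1
        · simpa [Set.indicator, ht] using h _ (measurableSet_lt measurable_const hf.ennreal_toReal)
        · have hempty : {x | t < (f x).toReal} = ∅ := by
            refine Set.eq_empty_of_forall_notMem fun x hx => ht (lt_of_lt_of_le hx ?_)
            exact ENNReal.toReal_le_of_le_ofReal zero_le_one (by simpa using hf1 x)
          simp [hempty]
    _ = c * (∫⁻ t in Set.Ioi (0 : ℝ), ν {x | t < (f x).toReal}) + d := by
        rw [lintegral_add_left (hmeas.const_mul c), lintegral_const_mul c hmeas,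
          lintegral_indicator_const measurableSet_Iio,
          Measure.restrict_apply measurableSet_Iio, Set.inter_comm, Set.Ioi_inter_Iio]
        simp

/-- Parallel composition of setwise comparisons, with values in `ℝ≥0∞`. -/
theorem prod_apply_le_mul_prod_apply_add {X Y : Type*} [MeasurableSpace X] [MeasurableSpace Y]
    {μ₁ ν₁ : Measure X} {μ₂ ν₂ : Measure Y}
    [IsProbabilityMeasure μ₁] [IsProbabilityMeasure μ₂] [SFinite ν₂] {c₁ c₂ d₁ d₂ : ℝ≥0∞}
    (h₁ : ∀ S, MeasurableSet S → μ₁ S ≤ c₁ * ν₁ S + d₁)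
    (h₂ : ∀ S, MeasurableSet S → μ₂ S ≤ c₂ * ν₂ S + d₂)
    {S : Set (X × Y)} (hS : MeasurableSet S) :
    μ₁.prod μ₂ S ≤ c₁ * c₂ * ν₁.prod ν₂ S + d₁ + d₂ := by
  have hν : Measurable fun x => ν₂ (Prod.mk x ⁻¹' S) := measurable_measure_prodMk_left hS
  have hg : Measurable fun x => min 1 (c₂ * ν₂ (Prod.mk x ⁻¹' S)) :=
    measurable_const.min (hν.const_mul c₂)
  rw [Measure.prod_apply hS, Measure.prod_apply hS]
  calc ∫⁻ x, μ₂ (Prod.mk x ⁻¹' S) ∂μ₁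
      ≤ ∫⁻ x, (min 1 (c₂ * ν₂ (Prod.mk x ⁻¹' S)) + d₂) ∂μ₁ := by
        refine lintegral_mono fun x => ?_
        rw [min_add]
        exact le_min (prob_le_one.trans le_self_add) (h₂ _ (measurable_prodMk_left hS))
    _ = ∫⁻ x, min 1 (c₂ * ν₂ (Prod.mk x ⁻¹' S)) ∂μ₁ + d₂ := by
        rw [lintegral_add_left hg]
        simp
    _ ≤ c₁ * ∫⁻ x, min 1 (c₂ * ν₂ (Prod.mk x ⁻¹' S)) ∂ν₁ + d₁ + d₂ := by
        gcongr
        exact lintegral_le_mul_lintegral_add_of_le_one h₁ hg fun _ => min_le_left _ _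
    _ ≤ c₁ * ∫⁻ x, c₂ * ν₂ (Prod.mk x ⁻¹' S) ∂ν₁ + d₁ + d₂ := by
        gcongr
        exact min_le_right _ _
    _ = c₁ * c₂ * ∫⁻ x, ν₂ (Prod.mk x ⁻¹' S) ∂ν₁ + d₁ + d₂ := by
        rw [lintegral_const_mul c₂ hν, mul_assoc]

/-- A real-valued comparison of measures, restated in `ℝ≥0∞`. -/
theorem measure_le_ofReal_mul_add {X : Type*} [MeasurableSpace X] {μ ν : Measure X}
    [IsFiniteMeasure μ] [IsFiniteMeasure ν] {c d : ℝ} (hc : 0 ≤ c) (hd : 0 ≤ d) {S : Set X}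
    (h : (μ S).toReal ≤ c * (ν S).toReal + d) :
    μ S ≤ ENNReal.ofReal c * ν S + ENNReal.ofReal d := by
  rw [← ENNReal.ofReal_toReal (measure_ne_top μ S), ← ENNReal.ofReal_toReal (measure_ne_top ν S),
    ← ENNReal.ofReal_mul hc, ← ENNReal.ofReal_add (by positivity) hd]
  exact ENNReal.ofReal_le_ofReal h

/-- Parallel composition of differentially private measurements. -/
theorem parallel_composition_DP
    {X₁ X₂ : Type*} [MeasurableSpace X₁] [MeasurableSpace X₂]
    (μ₁ ν₁ : Measure X₁) (μ₂ ν₂ : Measure X₂)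
    [IsProbabilityMeasure μ₁] [IsProbabilityMeasure ν₁]
    [IsProbabilityMeasure μ₂] [IsProbabilityMeasure ν₂]
    (ε₁ ε₂ δ₁ δ₂ : ℝ)
    (hε₁ : 0 ≤ ε₁) (hε₂ : 0 ≤ ε₂) (hδ₁ : 0 ≤ δ₁) (hδ₂ : 0 ≤ δ₂)
    (h₁ : ∀ S₁ : Set X₁, MeasurableSet S₁ →
      (μ₁ S₁).toReal ≤ Real.exp ε₁ * (ν₁ S₁).toReal + δ₁)
    (h₂ : ∀ S₂ : Set X₂, MeasurableSet S₂ →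
      (μ₂ S₂).toReal ≤ Real.exp ε₂ * (ν₂ S₂).toReal + δ₂) :
    ∀ S : Set (X₁ × X₂), MeasurableSet S →
      ((μ₁.prod μ₂) S).toReal ≤ Real.exp (ε₁ + ε₂) * ((ν₁.prod ν₂) S).toReal + δ₁ + δ₂ := by
  intro S hS
  have key := prod_apply_le_mul_prod_apply_add
    (fun T hT => measure_le_ofReal_mul_add (Real.exp_nonneg ε₁) hδ₁ (h₁ T hT))
    (fun T hT => measure_le_ofReal_mul_add (Real.exp_nonneg ε₂) hδ₂ (h₂ T hT)) hS
  rw [← ENNReal.ofReal_mul (Real.exp_nonneg ε₁), ← Real.exp_add,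
    ← ENNReal.ofReal_toReal (measure_ne_top (ν₁.prod ν₂) S),
    ← ENNReal.ofReal_mul (Real.exp_nonneg _), ← ENNReal.ofReal_add (by positivity) hδ₁,
    ← ENNReal.ofReal_add (by positivity) hδ₂] at key
  exact ENNReal.toReal_le_of_le_ofReal (by positivity) key
end
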